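/- arXiv:1409.2663 — 3 statements merged into one kernel-verified Lean document; each statement's English description precedes it below -/
import Mathlib

section
/- Consider the AR(1)-model with ARCH(1) errors Xₙ = αX_{n−1} + (β + λX_{n−1}²)^{1/2}εₙ with parameter (α,β,λ) ∈ ℝ×(0,∞)², where ε, ε₁, ε₂, … are iid with a nontrivial symmetric distribution and independent of X₀; without loss of generality α ≥ 0. Assume E log(α + λ^{1/2}|ε|) < 0 and that M := (α + λ^{1/2}η)², where η is a copy of ε, satisfies (IRT-1)–(IRT-3) for some κ > 0. Then the chain has a unique stationary law π, and if X ∼ π is independent of (η, M) then lim_{t→∞} t^{2κ} P(X > t) = E(Ψ(X²)^κ − (MX²)^κ)/(2κμ_κ) > 0, where μ_κ = EM^κ log M and Ψ(w) = (α + λ^{1/2}η)²w + 2αβη w^{1/2}/((β + λw)^{1/2} + (λw)^{1/2}) + βη². -/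
open MeasureTheory ProbabilityTheory Filter Set

noncomputable section

/-- Conditions (IRT-1)–(IRT-3) of Goldie's implicit renewal theorem. -/
def SatisfiesIRT {Θ : Type*} [MeasurableSpace Θ] (ν : Measure Θ) (M : Θ → ℝ) (κ : ℝ) :
    Prop :=
  0 < κ ∧
  (∫ p, |M p| ^ κ ∂ν) = 1 ∧
  Integrable (fun p => |M p| ^ κ * max (Real.log |M p|) 0) ν ∧
  ∀ c : ℝ, 0 < ν {p | M p ≠ 0 ∧ ∀ k : ℤ, Real.log |M p| ≠ c * k}

/-- If `δ` asymptotically dominates none of its averages, then asymptotic maximality of `δ` along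
a filter propagates to translates by points of the support of the averaging measure. -/
lemma tendsto_shift_of_average {F : Measure ℝ} [IsProbabilityMeasure F] {δ : ℝ → ℝ} {K B M : ℝ}
    (hK : 0 ≤ K) (hLip : ∀ x y, |δ x - δ y| ≤ K * |x - y|) (hcont : Continuous δ)
    (hB : ∀ x, |δ x| ≤ B)
    (hF : Tendsto (fun x => δ x - ∫ ξ, δ (x - ξ) ∂F) atTop (nhds 0))
    (hM : ∀ ε > 0, ∀ᶠ x in atTop, δ x < M + ε)
    {a : ℝ} (ha : ∀ ρ > 0, 0 < F (Metric.ball a ρ))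
    {G : Filter ℝ} [G.IsCountablyGenerated] (hG : G ≤ atTop) (hδ : Tendsto δ G (nhds M)) :
    Tendsto (fun x => δ (x - a)) G (nhds M) := by
  have hsub : ∀ ξ : ℝ, Tendsto (fun x => x - ξ) atTop atTop := fun ξ =>
    tendsto_atTop_add_const_right _ _ tendsto_id
  have hint : ∀ x, Integrable (fun ξ => δ (x - ξ)) F := fun x =>
    Integrable.of_bound (by fun_prop) B (Eventually.of_forall fun ξ => by simpa using hB _)
  have hint' : ∀ x, Integrable (fun ξ => max (δ (x - ξ)) M) F := fun x =>
    (hint x).sup (integrable_const M)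
  have hmax : Tendsto (fun x => ∫ ξ, max (δ (x - ξ)) M ∂F) G (nhds (∫ _, M ∂F)) := by
    refine tendsto_integral_filter_of_dominated_convergence (fun _ => max B |M|) ?_ ?_
      (integrable_const _) ?_
    · exact Eventually.of_forall fun x => (hint' x).aestronglyMeasurable
    · refine Eventually.of_forall fun x => Eventually.of_forall fun ξ => ?_
      exact (abs_max_le_max_abs_abs).trans (max_le_max_right _ (hB _))
    · refine Eventually.of_forall fun ξ => ?_
      refine Tendsto.mono_left ?_ hG
      refine tendsto_order.2 ⟨fun c hc => Eventually.of_forall fun x => lt_max_of_lt_right hc,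
        fun c hc => ?_⟩
      filter_upwards [(hsub ξ).eventually (hM (c - M) (by linarith))] with x hx
      exact max_lt (by linarith) hc
  have hmax2 : Tendsto (fun x => ∫ ξ, (max (δ (x - ξ)) M - δ (x - ξ)) ∂F) G (nhds 0) := by
    have h1 := hmax.sub (hδ.sub (hF.mono_left hG))
    simp only [integral_const, probReal_univ, one_smul, sub_zero, sub_self] at h1
    refine h1.congr fun x => ?_
    rw [integral_sub (hint' x) (hint x)]
    ring
  refine tendsto_order.2 ⟨fun c hc => ?_, fun c hc => ?_⟩
  · obtain ⟨ρ, hρ, hρc⟩ : ∃ ρ > 0, K * ρ < (M - c) / 2 := by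
      refine ⟨(M - c) / (4 * (K + 1)), by apply div_pos <;> linarith, ?_⟩
      rw [← mul_div_assoc, div_lt_div_iff₀ (by linarith) (by norm_num)]
      nlinarith
    have hp : 0 < F.real (Metric.ball a ρ) :=
      ENNReal.toReal_pos (ha ρ hρ).ne' (measure_ne_top _ _)
    filter_upwards [hmax2.eventually (gt_mem_nhds (show 0 < (M - c) / 2 * F.real (Metric.ball a ρ)
      by apply mul_pos _ hp; linarith))] with x hx
    by_contra! hcx
    have h2 : ∫ ξ in Metric.ball a ρ, ((M - c) / 2) ∂F ≤
        ∫ ξ, (max (δ (x - ξ)) M - δ (x - ξ)) ∂F := by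
      calc _ ≤ ∫ ξ in Metric.ball a ρ, (max (δ (x - ξ)) M - δ (x - ξ)) ∂F := by
            refine setIntegral_mono_on (integrable_const _).integrableOn
              ((hint' x).sub (hint x)).integrableOn measurableSet_ball fun ξ hξ => ?_
            have h3 := hLip (x - ξ) (x - a)
            have h4 : |x - ξ - (x - a)| < ρ := by
              rw [Metric.mem_ball, Real.dist_eq] at hξ
              rw [show x - ξ - (x - a) = -(ξ - a) by ring, abs_neg]; exact hξ
            have h5 := (abs_le.1 h3).2
            have h6 : K * |x - ξ - (x - a)| ≤ K * ρ := by gcongr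
            have := le_max_right (δ (x - ξ)) M
            linarith
        _ ≤ _ := setIntegral_le_integral ((hint' x).sub (hint x))
            (Eventually.of_forall fun ξ => by simp)
    rw [setIntegral_const, smul_eq_mul, mul_comm] at h2
    linarith
  · filter_upwards [hG ((hsub a).eventually (hM (c - M) (by linarith)))] with x hx
    linarith

lemma eventually_increment_lt {F : Measure ℝ} [IsProbabilityMeasure F] {f : ℝ → ℝ} {K B : ℝ}
    (hK : 0 ≤ K) (hLip : ∀ x y, |f x - f y| ≤ K * |x - y|) (hcont : Continuous f)
    (hB : ∀ x, |f x| ≤ B)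
    (hF : Tendsto (fun x => f x - ∫ ξ, f (x - ξ) ∂F) atTop (nhds 0))
    {a : ℝ} (ha : ∀ ρ > 0, 0 < F (Metric.ball a ρ)) {ε : ℝ} (hε : 0 < ε) :
    ∀ᶠ x in atTop, f x - f (x - a) < ε := by
  set δ : ℝ → ℝ := fun x => f x - f (x - a) with hδ
  have hB' : ∀ x, |δ x| ≤ 2 * B := fun x => by
    have := abs_sub (f x) (f (x - a)); have := hB x; have := hB (x - a)
    simp only [hδ]; linarith
  have hsub : ∀ ξ : ℝ, Tendsto (fun x => x - ξ) atTop atTop := fun ξ =>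
    tendsto_atTop_add_const_right _ _ tendsto_id
  have hbdd : IsBoundedUnder (· ≤ ·) atTop δ := isBoundedUnder_of ⟨2 * B, fun x => (abs_le.1 (hB' x)).2⟩
  have hbdd' : IsBoundedUnder (· ≥ ·) atTop δ :=
    isBoundedUnder_of ⟨-(2 * B), fun x => (abs_le.1 (hB' x)).1⟩
  set M := limsup δ atTop with hMdef
  have hM : ∀ ε > 0, ∀ᶠ x in atTop, δ x < M + ε := fun ε hε =>
    eventually_lt_of_limsup_lt (by linarith) hbdd
  have hint : ∀ x, Integrable (fun ξ => f (x - ξ)) F := fun x =>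
    Integrable.of_bound (by fun_prop) B (Eventually.of_forall fun ξ => by simpa using hB _)
  have hFδ : Tendsto (fun x => δ x - ∫ ξ, δ (x - ξ) ∂F) atTop (nhds 0) := by
    have h := hF.sub (hF.comp (hsub a))
    rw [sub_zero] at h
    refine h.congr fun x => ?_
    simp only [hδ, Function.comp]
    rw [integral_sub (hint x) (by simpa [sub_right_comm] using hint (x - a))]
    simp only [sub_right_comm _ a]
    ring
  have hLipδ : ∀ x y, |δ x - δ y| ≤ (2 * K) * |x - y| := fun x y => by
    have h1 := hLip x y
    have h2 := hLip (x - a) (y - a)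
    rw [sub_sub_sub_cancel_right] at h2
    calc |δ x - δ y| = |(f x - f y) - (f (x - a) - f (y - a))| := by simp only [hδ]; ring_nf
      _ ≤ _ := (abs_sub _ _).trans (by linarith)
  have hcontδ : Continuous δ := by fun_prop
  set G : Filter ℝ := atTop ⊓ comap δ (nhds M) with hG
  have hGne : G.NeBot := by
    have h : MapClusterPt M atTop δ := (isGreatest_mapClusterPt_limsup hbdd'.isCoboundedUnder_le hbdd).1
    rw [← map_neBot_iff δ, hG, Filter.push_pull, inf_comm]
    exact h
  have hstep : ∀ j : ℕ, Tendsto (fun x => δ (x - j * a)) G (nhds M) := by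
    intro j
    induction j with
    | zero => simpa using (tendsto_comap.mono_left inf_le_right : Tendsto δ G (nhds M))
    | succ j ih =>
      have h1 : Tendsto δ (map (fun x => x - j * a) G) (nhds M) := by rwa [tendsto_map'_iff]
      have h2 : map (fun x => x - j * a) G ≤ atTop := (hsub (j * a)).mono_left inf_le_left
      have := tendsto_shift_of_average (by linarith) hLipδ hcontδ hB' hFδ hM ha h2 h1
      rw [tendsto_map'_iff] at this
      refine this.congr fun x => ?_
      simp only [Function.comp]; congr 1; push_cast; ring
  have hM0 : M ≤ 0 := by
    by_contra! hpos
    obtain ⟨n, hn⟩ := exists_nat_gt (2 * B / M)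
    have hsum : Tendsto (fun x => ∑ j ∈ Finset.range n, δ (x - j * a)) G
        (nhds (∑ _j ∈ Finset.range n, M)) := tendsto_finsetSum _ fun j _ => hstep j
    have hle := le_of_tendsto hsum (b := 2 * B) (Eventually.of_forall fun x => by
      have h1 : ∑ j ∈ Finset.range n, δ (x - j * a) = f x - f (x - n * a) := by
        have := Finset.sum_range_sub' (fun j : ℕ => f (x - j * a)) n
        simp only [Nat.cast_zero, zero_mul, sub_zero] at this
        rw [← this]
        refine Finset.sum_congr rfl fun j _ => ?_
        simp only [hδ]; congr 2; push_cast; ring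
      have := (abs_le.1 (hB x)).2; have := (abs_le.1 (hB (x - n * a))).1
      linarith)
    rw [div_lt_iff₀ hpos] at hn
    simp at hle
    linarith
  filter_upwards [hM ε hε] with x hx
  linarith

lemma tendsto_increment_zero {F : Measure ℝ} [IsProbabilityMeasure F] {f : ℝ → ℝ} {K B : ℝ}
    (hK : 0 ≤ K) (hLip : ∀ x y, |f x - f y| ≤ K * |x - y|) (hcont : Continuous f)
    (hB : ∀ x, |f x| ≤ B)
    (hF : Tendsto (fun x => f x - ∫ ξ, f (x - ξ) ∂F) atTop (nhds 0))
    (hnonar : ∀ c : ℝ, 0 < F {ξ | ∀ k : ℤ, ξ ≠ c * k}) (b : ℝ) :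
    Tendsto (fun x => f (x + b) - f x) atTop (nhds 0) := by
  have hadd : ∀ ξ : ℝ, Tendsto (fun x => x + ξ) atTop atTop := fun ξ =>
    tendsto_atTop_add_const_right _ _ tendsto_id
  let S : AddSubgroup ℝ :=
    { carrier := {b | Tendsto (fun x => f (x + b) - f x) atTop (nhds 0)}
      zero_mem' := by simp
      add_mem' := fun {a b} ha hb => by
        simp only [mem_ofPred_eq] at ha hb
        have h := (ha.comp (hadd b)).add hb
        rw [add_zero] at h
        refine h.congr fun x => ?_
        simp only [Function.comp]
        rw [add_assoc, add_comm b a]; ring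
      neg_mem' := fun {a} ha => by
        simp only [mem_ofPred_eq] at ha
        have h := (ha.comp (hadd (-a))).neg
        rw [neg_zero] at h
        refine h.congr fun x => ?_
        simp only [Function.comp, neg_add_cancel_right]
        ring }
  have hSsupp : ∀ a : ℝ, (∀ ρ > 0, 0 < F (Metric.ball a ρ)) → a ∈ S := by
    intro a ha
    rw [← neg_mem_iff]
    have h2 := fun ε (hε : 0 < ε) => eventually_increment_lt hK hLip hcont hB hF ha hε
    have h3 := fun ε (hε : 0 < ε) => eventually_increment_lt (f := fun x => - f x) hK
      (fun x y => by rw [neg_sub_neg, abs_sub_comm]; exact hLip x y) hcont.neg (by simpa using hB)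
      (by
        have := hF.neg
        rw [neg_zero] at this
        refine this.congr fun x => ?_
        rw [integral_neg]; ring) ha hε
    change Tendsto (fun x => f (x + -a) - f x) atTop (nhds 0)
    refine tendsto_order.2 ⟨fun c hc => ?_, fun c hc => ?_⟩
    · filter_upwards [h2 (-c) (by linarith)] with x hx
      rw [← sub_eq_add_neg]; linarith
    · filter_upwards [h3 c hc] with x hx
      rw [← sub_eq_add_neg]; linarith
  rcases S.dense_or_cyclic with hd | ⟨c, hc⟩
  · rw [Metric.tendsto_nhds]
    intro ε hε
    obtain ⟨s, hs, hsb⟩ := Metric.mem_closure_iff.1 (hd b) (ε / (2 * (K + 1)))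
      (div_pos hε (by linarith))
    have hs' : Tendsto (fun x => f (x + s) - f x) atTop (nhds 0) := hs
    filter_upwards [Metric.tendsto_nhds.1 hs' (ε / 2) (by linarith)] with x hx
    rw [Real.dist_eq, sub_zero] at hx ⊢
    rw [Real.dist_eq, lt_div_iff₀ (by linarith)] at hsb
    have h1 := hLip (x + b) (x + s)
    rw [add_sub_add_left_eq_sub] at h1
    have h2 : |f (x + b) - f x| ≤ |f (x + b) - f (x + s)| + |f (x + s) - f x| := abs_sub_le _ _ _
    nlinarith [abs_nonneg (b - s)]
  · exfalso
    obtain ⟨a, ha, hpos⟩ := exists_mem_forall_mem_nhdsWithin_pos_measure (hnonar c).ne'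
    have haS : a ∈ S := hSsupp a fun ρ hρ =>
      hpos _ (mem_nhdsWithin_of_mem_nhds (Metric.ball_mem_nhds a hρ))
    rw [hc, AddSubgroup.mem_closure_singleton] at haS
    obtain ⟨k, hk⟩ := haS
    exact ha k (by rw [← hk, zsmul_eq_mul, mul_comm])

/-- A renewal theorem in integrated form. -/
theorem tendsto_increment_of_renewal {F : Measure ℝ} [IsProbabilityMeasure F] {J : ℝ → ℝ}
    {K D : ℝ} (hLip : ∀ x y, |J x - J y| ≤ K * |x - y|)
    (hid : Integrable (fun ξ : ℝ => ξ) F)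
    (hJ : Tendsto (fun x => J x - ∫ ξ, J (x - ξ) ∂F) atTop (nhds D))
    (hmean : ∫ ξ, ξ ∂F ≠ 0)
    (hnonar : ∀ c : ℝ, 0 < F {ξ | ∀ k : ℤ, ξ ≠ c * k}) (a : ℝ) :
    Tendsto (fun x => J (x + a) - J x) atTop (nhds (a * (D / ∫ ξ, ξ ∂F))) := by
  have hK : 0 ≤ K := by have := (abs_nonneg _).trans (hLip 1 0); simpa using this
  have hadd : ∀ ξ : ℝ, Tendsto (fun x => x + ξ) atTop atTop := fun ξ =>
    tendsto_atTop_add_const_right _ _ tendsto_id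
  have hcont : Continuous J := by
    exact (LipschitzWith.of_dist_le_mul (K := ⟨K, hK⟩) fun x y => hLip x y).continuous
  have hdiff : ∀ x, Integrable (fun ξ => J x - J (x - ξ)) F := fun x => by
    refine (hid.abs.const_mul K).mono' (by fun_prop) (Eventually.of_forall fun ξ => ?_)
    simpa using hLip x (x - ξ)
  have hint : ∀ x, Integrable (fun ξ => J (x - ξ)) F := fun x => by
    simpa [Pi.sub_def] using (integrable_const (J x)).sub (hdiff x)
  have hincr : ∀ a b : ℝ, Tendsto (fun x => (J (x + b + a) - J (x + b)) - (J (x + a) - J x)) atTop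
      (nhds 0) := by
    intro a b
    refine tendsto_increment_zero (F := F) (f := fun x => J (x + a) - J x) (K := 2 * K)
      (B := K * |a|) (by linarith) (fun x y => ?_) (by fun_prop) (fun x => ?_) ?_ hnonar b
    · have h1 := hLip x y
      have h2 := hLip (x + a) (y + a)
      rw [add_sub_add_right_eq_sub] at h2
      calc |J (x + a) - J x - (J (y + a) - J y)| = |(J (x + a) - J (y + a)) - (J x - J y)| := by
            ring_nf
        _ ≤ _ := (abs_sub _ _).trans (by linarith)
    · simpa using hLip (x + a) x
    · have h := (hJ.comp (hadd a)).sub hJ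
      rw [sub_self] at h
      refine h.congr fun x => ?_
      simp only [Function.comp]
      rw [integral_sub (by simpa [sub_add_eq_add_sub] using hint (x + a)) (hint x)]
      simp only [sub_add_eq_add_sub]
      ring
  have hlin : ∀ ξ : ℝ, Tendsto (fun x => (J (x + ξ) - J x) - ξ * (J (x + 1) - J x)) atTop
      (nhds 0) := by
    intro ξ
    rw [tendsto_iff_ultrafilter]
    intro g hg
    have hex : ∀ a : ℝ, ∃ l, Tendsto (fun x => J (x + a) - J x) g (nhds l) := by
      intro a
      obtain ⟨l, -, hl⟩ := (isCompact_Icc (a := -(K * |a|)) (b := K * |a|)).ultrafilter_le_nhds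
        (g.map fun x => J (x + a) - J x) (by
          rw [le_principal_iff]
          refine mem_map.2 (Eventually.of_forall (fun x => ?_))
          have := hLip (x + a) x
          rw [add_sub_cancel_left] at this
          exact abs_le.1 this)
      exact ⟨l, hl⟩
    choose l hl using hex
    have hladd : ∀ a b, l (a + b) = l a + l b := by
      intro a b
      have h := ((hincr b a).mono_left hg).add ((hl a).add (hl b))
      rw [zero_add] at h
      refine tendsto_nhds_unique (hl (a + b)) (h.congr fun x => ?_)
      rw [add_assoc]; ring
    have hlcont : Continuous l := by
      refine (LipschitzWith.of_dist_le_mul (K := ⟨K, hK⟩) fun a b => ?_).continuous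
      refine le_of_tendsto ((hl a).sub (hl b)).abs (Eventually.of_forall fun x => ?_)
      have := hLip (x + a) (x + b)
      rw [add_sub_add_left_eq_sub] at this
      rw [sub_sub_sub_cancel_right]
      exact this
    have h1 : l ξ = ξ * l 1 := by
      have := map_real_smul (AddMonoidHom.mk' l hladd) hlcont ξ 1
      simpa using this
    have h := (hl ξ).sub ((hl 1).const_mul ξ)
    rwa [h1, sub_self] at h
  have hone : Tendsto (fun x => J (x + 1) - J x) atTop (nhds (D / ∫ ξ, ξ ∂F)) := by
    have hdct : Tendsto (fun x => ∫ ξ, (J x - J (x - ξ) - ξ * (J (x + 1) - J x)) ∂F) atTop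
        (nhds (∫ _, 0 ∂F)) := by
      refine tendsto_integral_filter_of_dominated_convergence (fun ξ => 2 * K * |ξ|) ?_ ?_
        (hid.abs.const_mul _) ?_
      · exact Eventually.of_forall fun x => by fun_prop
      · refine Eventually.of_forall fun x => Eventually.of_forall fun ξ => ?_
        have h1 := hLip x (x - ξ)
        have h2 := hLip (x + 1) x
        simp only [sub_sub_cancel, add_sub_cancel_left, abs_one, mul_one] at h1 h2
        rw [Real.norm_eq_abs]
        refine (abs_sub _ _).trans ?_
        rw [abs_mul]
        nlinarith [abs_nonneg ξ]
      · refine Eventually.of_forall fun ξ => ?_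
        have h := (hlin (-ξ)).neg.add ((hlin 0).const_mul 0)
        simp only [neg_zero, mul_zero, add_zero, zero_mul] at h
        refine h.congr fun x => ?_
        rw [← sub_eq_add_neg]; ring
    have h := (hJ.sub hdct).div_const (∫ ξ, ξ ∂F)
    rw [integral_zero, sub_zero] at h
    refine h.congr fun x => ?_
    rw [integral_sub (hdiff x) (hid.mul_const _), integral_mul_const,
      integral_sub (integrable_const _) (hint x)]
    simp only [integral_const, probReal_univ, one_smul]
    field_simp
    ring
  have h := (hlin a).add (hone.const_mul a)
  rw [zero_add] at h
  exact h.congr fun x => by ring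

lemma abs_sub_le_of_le_exp {J : ℝ → ℝ} {C : ℝ} (hmono : Monotone J)
    (h : ∀ x y, x ≤ y → J y - J x ≤ C * (Real.exp (y - x) - 1)) (hC : 0 ≤ C) (x y : ℝ) :
    |J x - J y| ≤ 2 * C * |x - y| := by
  have hstep : ∀ (d : ℝ), 0 ≤ d → d ≤ 1 → ∀ (n : ℕ) (x : ℝ),
      J (x + n * d) - J x ≤ n * (2 * C * d) := by
    intro d hd hd1 n x
    induction n with
    | zero => simp
    | succ n ih =>
      have h1 := h (x + n * d) (x + (n + 1 : ℕ) * d) (by push_cast; nlinarith)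
      have h2 : x + (n + 1 : ℕ) * d - (x + n * d) = d := by push_cast; ring
      rw [h2] at h1
      have h3 := Real.abs_exp_sub_one_le (x := d) (by rwa [abs_of_nonneg hd])
      rw [abs_of_nonneg hd] at h3
      have h4 : C * (Real.exp d - 1) ≤ C * (2 * d) := by
        gcongr; exact (le_abs_self _).trans h3
      push_cast at *
      linarith
  wlog hxy : x ≤ y generalizing x y
  · rw [abs_sub_comm, abs_sub_comm x y]; exact this y x (le_of_not_ge hxy)
  rw [abs_sub_comm, abs_sub_comm x, abs_of_nonneg (sub_nonneg.2 (hmono hxy)),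
    abs_of_nonneg (sub_nonneg.2 hxy)]
  obtain ⟨n, hn⟩ := exists_nat_gt (y - x)
  have hn0 : (0 : ℝ) < n := by linarith
  have := hstep ((y - x) / n) (by apply div_nonneg <;> linarith)
    ((div_le_one hn0).2 hn.le) n x
  rw [show x + n * ((y - x) / n) = y by field_simp; ring] at this
  calc J y - J x ≤ _ := this
    _ = _ := by field_simp

lemma tendsto_div_exp_sub_one :
    Tendsto (fun a : ℝ => a / (Real.exp a - 1)) (nhdsWithin 0 (Ioi 0)) (nhds 1) := by
  have h := (Real.hasDerivAt_exp 0).tendsto_slope_zero_right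
  simp only [zero_add, Real.exp_zero, smul_eq_mul] at h
  have := h.inv₀ one_ne_zero
  rw [inv_one] at this
  refine this.congr fun a => ?_
  rw [mul_inv, inv_inv]; rfl

/-- Passage from increments of truncated means to tails. -/
lemma tendsto_tail_of_increment {H J : ℝ → ℝ} {L : ℝ}
    (hJ : ∀ x y, x ≤ y → J y - J x ≤ (Real.exp y - Real.exp x) * H (Real.exp x))
    (hJ' : ∀ x y, x ≤ y → (Real.exp y - Real.exp x) * H (Real.exp y) ≤ J y - J x)
    (hlim : ∀ a, Tendsto (fun x => J (x + a) - J x) atTop (nhds (a * L))) :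
    Tendsto (fun t => t * H t) atTop (nhds L) := by
  have key : Tendsto (fun x => Real.exp x * H (Real.exp x)) atTop (nhds L) := by
    have l1 : Tendsto (fun a : ℝ => a * L / (Real.exp a - 1)) (nhdsWithin 0 (Ioi 0)) (nhds L) := by
      have := tendsto_div_exp_sub_one.mul_const L
      rw [one_mul] at this
      exact this.congr fun a => by ring
    have l2 : Tendsto (fun a : ℝ => a * L / (1 - Real.exp (-a))) (nhdsWithin 0 (Ioi 0))
        (nhds L) := by
      have h0 : Tendsto (fun a : ℝ => Real.exp a) (nhdsWithin 0 (Ioi 0)) (nhds 1) := by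
        have := (Real.continuous_exp.tendsto 0).mono_left (nhdsWithin_le_nhds (s := Ioi 0))
        rwa [Real.exp_zero] at this
      have := l1.mul h0
      rw [mul_one] at this
      refine this.congr' ?_
      filter_upwards [self_mem_nhdsWithin] with a ha
      have h1 : Real.exp a - 1 ≠ 0 := by
        replace ha : 0 < a := ha
        have := Real.add_one_lt_exp ha.ne'
        intro h; linarith
      rw [Real.exp_neg]
      have := Real.exp_pos a
      have h2 : 1 - (Real.exp a)⁻¹ = (Real.exp a - 1) / Real.exp a := by field_simp
      rw [h2]
      field_simp
    refine tendsto_order.2 ⟨fun c hc => ?_, fun c hc => ?_⟩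
    · obtain ⟨a, hac, ha⟩ := ((l1.eventually (lt_mem_nhds hc)).and self_mem_nhdsWithin).exists
      replace ha : 0 < a := ha
      have h1 : 0 < Real.exp a - 1 := by have := Real.add_one_lt_exp ha.ne'; linarith
      filter_upwards [((hlim a).div_const (Real.exp a - 1)).eventually (lt_mem_nhds hac)] with x hx
      refine hx.trans_le ((div_le_iff₀ h1).2 ((hJ x (x + a) (by linarith)).trans (le_of_eq ?_)))
      rw [Real.exp_add]; ring
    · obtain ⟨a, hac, ha⟩ := ((l2.eventually (gt_mem_nhds hc)).and self_mem_nhdsWithin).exists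
      replace ha : 0 < a := ha
      have h1 : 0 < 1 - Real.exp (-a) := by
        have : Real.exp (-a) < 1 := by simpa using ha
        linarith
      have h2 := ((hlim a).comp (tendsto_atTop_add_const_right _ (-a) tendsto_id)).div_const
        (1 - Real.exp (-a))
      filter_upwards [h2.eventually (gt_mem_nhds hac)] with x hx
      refine lt_of_le_of_lt ((le_div_iff₀ h1).2 (le_trans (le_of_eq ?_)
        (hJ' (x - a) x (by linarith)))) (by simpa [← sub_eq_add_neg] using hx)
      rw [sub_eq_add_neg x a, Real.exp_add]; ring
  refine (key.comp Real.tendsto_log_atTop).congr' ?_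
  filter_upwards [eventually_gt_atTop 0] with t ht
  simp [Real.exp_log ht]

/-- A tail function whose mass on geometric blocks is `O(1/t)` is itself `O(1/t)`. -/
lemma mul_tail_le_of_block_le {H : ℝ → ℝ} {q C : ℝ} (hq : 1 < q) (hC : 0 ≤ C)
    (hH : Tendsto H atTop (nhds 0)) (hblock : ∀ t > 0, t * (H t - H (q * t)) ≤ C)
    {t : ℝ} (ht : 0 < t) : t * H t ≤ C / (1 - q⁻¹) := by
  have hq1 : 0 < 1 - q⁻¹ := by have := inv_lt_one_of_one_lt₀ hq; linarith
  have hq0 : 0 < q := by linarith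
  set B := C / (1 - q⁻¹)
  have hB : C = B * (1 - q⁻¹) := (div_mul_cancel₀ _ hq1.ne').symm
  have hB0 : 0 ≤ B := div_nonneg hC hq1.le
  have hn : ∀ n : ℕ, t * H t ≤ B * (1 - q⁻¹ ^ n) + t * H (q ^ n * t) := by
    intro n
    induction n with
    | zero => simp
    | succ n ih =>
      have h1 := hblock (q ^ n * t) (by positivity)
      have h2 : t * H (q ^ n * t) ≤ q⁻¹ ^ n * C + t * H (q ^ (n + 1) * t) := by
        have h3 := mul_le_mul_of_nonneg_left h1 (show 0 ≤ q⁻¹ ^ n by positivity)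
        have h4 : q⁻¹ ^ n * q ^ n = 1 := by rw [← mul_pow, inv_mul_cancel₀ hq0.ne', one_pow]
        have h5 : q⁻¹ ^ n * (q ^ n * t * (H (q ^ n * t) - H (q * (q ^ n * t)))) =
            t * (H (q ^ n * t) - H (q * (q ^ n * t))) := by
          rw [← mul_assoc, ← mul_assoc, h4, one_mul]
        rw [h5] at h3
        rw [pow_succ', mul_assoc]; linarith
      rw [hB] at h2
      rw [pow_succ]
      linarith
  have hlim : Tendsto (fun n : ℕ => B + t * H (q ^ n * t)) atTop (nhds (B + t * 0)) :=
    ((hH.comp ((tendsto_pow_atTop_atTop_of_one_lt hq).atTop_mul_const ht)).const_mul t).const_add B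
  rw [mul_zero, add_zero] at hlim
  refine ge_of_tendsto' hlim fun n => (hn n).trans ?_
  have : 0 ≤ q⁻¹ ^ n := by positivity
  nlinarith

lemma integral_mul_log_pos {Θ : Type*} [MeasurableSpace Θ] {ν : Measure Θ}
    [IsProbabilityMeasure ν] {N : Θ → ℝ} (hN0 : ∀ θ, 0 ≤ N θ) (hN1 : ∫ θ, N θ ∂ν = 1)
    (hlog : Integrable (fun θ => N θ * Real.log (N θ)) ν)
    (hne : 0 < ν {θ | N θ ≠ 1}) : 0 < ∫ θ, N θ * Real.log (N θ) ∂ν := by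
  have hNi : Integrable N ν := by
    by_contra h; rw [integral_undef h] at hN1; exact zero_ne_one hN1
  have hle : ∀ θ, 0 ≤ N θ * Real.log (N θ) - (N θ - 1) := fun θ => by
    rcases (hN0 θ).eq_or_lt with h | h
    · rw [← h]; simp
    · have := Real.one_sub_inv_le_log_of_pos h
      have := mul_le_mul_of_nonneg_left this h.le
      rw [mul_sub, mul_inv_cancel₀ h.ne'] at this
      linarith
  have hNi1 : Integrable (fun θ => N θ - 1) ν := hNi.sub (integrable_const 1)
  have hint := hlog.sub hNi1
  have hpos : 0 < ∫ θ, (N θ * Real.log (N θ) - (N θ - 1)) ∂ν := by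
    rw [integral_pos_iff_support_of_nonneg hle hint]
    refine hne.trans_le (measure_mono fun θ hθ => ?_)
    rw [Function.mem_support]
    intro h
    apply hθ
    rcases (hN0 θ).eq_or_lt with h0 | h0
    · rw [← h0] at h; simp at h
    · by_contra h1
      have h2 : Real.log (N θ)⁻¹ < (N θ)⁻¹ - 1 :=
        Real.log_lt_sub_one_of_pos (inv_pos.2 h0) (by simpa using h1)
      rw [Real.log_inv] at h2
      have := mul_lt_mul_of_pos_left h2 h0
      rw [mul_sub, mul_inv_cancel₀ h0.ne'] at this
      linarith
  rw [integral_sub hlog hNi1, integral_sub hNi (integrable_const 1),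
    hN1] at hpos
  simpa using hpos

lemma exists_lt_one_measure_le_pos {Θ : Type*} [MeasurableSpace Θ] {ν : Measure Θ}
    [IsProbabilityMeasure ν] {N : Θ → ℝ} (hN1 : ∫ θ, N θ ∂ν = 1)
    (hne : 0 < ν {θ | N θ ≠ 1}) : ∃ m, 0 < m ∧ m < 1 ∧ 0 < ν {θ | N θ ≤ m} := by
  by_contra! hcon
  have hNi : Integrable N ν := by
    by_contra h; rw [integral_undef h] at hN1; exact zero_ne_one hN1
  have hge : ∀ᵐ θ ∂ν, 1 ≤ N θ := by
    have h : ∀ n : ℕ, ∀ᵐ θ ∂ν, 1 - 1 / ((n : ℝ) + 2) < N θ := fun n => by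
      have h1 : (1 : ℝ) / ((n : ℝ) + 2) < 1 := by
        rw [div_lt_one (by positivity)]; linarith [(Nat.cast_nonneg n : (0 : ℝ) ≤ n)]
      have h2 : (0 : ℝ) < 1 / ((n : ℝ) + 2) := by positivity
      have := le_antisymm (hcon (1 - 1 / ((n : ℝ) + 2)) (by linarith) (by linarith)) (zero_le)
      rw [ae_iff]; simpa using this
    filter_upwards [ae_all_iff.2 h] with θ hθ
    by_contra! hlt
    obtain ⟨n, hn⟩ := exists_nat_one_div_lt (sub_pos.2 hlt)
    have h1 := hθ n
    have h2 : (1 : ℝ) / ((n : ℝ) + 2) ≤ 1 / ((n : ℝ) + 1) := by gcongr; norm_num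
    linarith
  have h0 : ∀ᵐ θ ∂ν, N θ - 1 = 0 := by
    have hi := hNi.sub (integrable_const (μ := ν) (1 : ℝ))
    refine (integral_eq_zero_iff_of_nonneg_ae (f := fun θ => N θ - 1) ?_ hi).1 ?_
    · filter_upwards [hge] with θ hθ using sub_nonneg.2 hθ
    · rw [integral_sub hNi (integrable_const _), hN1]; simp
  refine hne.ne' ?_
  rw [ae_iff] at h0
  simpa [sub_eq_zero] using h0

/-- Law of `log N` under the exponentially tilted measure `N dν`. -/
def tiltedLogLaw {Θ : Type*} [MeasurableSpace Θ] (ν : Measure Θ) (N : Θ → ℝ) : Measure ℝ :=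
  (ν.withDensity fun θ => ENNReal.ofReal (N θ)).map fun θ => Real.log (N θ)

section Tilted

variable {Θ : Type*} [MeasurableSpace Θ] {ν : Measure Θ} {N : Θ → ℝ}

lemma isProbabilityMeasure_tiltedLogLaw (hN : Measurable N) (hN0 : ∀ θ, 0 ≤ N θ)
    (hN1 : ∫ θ, N θ ∂ν = 1) : IsProbabilityMeasure (tiltedLogLaw ν N) := by
  have hNi : Integrable N ν := by
    by_contra h; rw [integral_undef h] at hN1; exact zero_ne_one hN1
  have : IsProbabilityMeasure (ν.withDensity fun θ => ENNReal.ofReal (N θ)) := by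
    refine ⟨?_⟩
    rw [withDensity_apply _ MeasurableSet.univ, Measure.restrict_univ,
      ← ofReal_integral_eq_lintegral_ofReal hNi (Eventually.of_forall hN0), hN1, ENNReal.ofReal_one]
  exact Measure.isProbabilityMeasure_map (by fun_prop)

lemma integral_tiltedLogLaw (hN : Measurable N) (hN0 : ∀ θ, 0 ≤ N θ) {g : ℝ → ℝ}
    (hg : Measurable g) :
    ∫ ξ, g ξ ∂(tiltedLogLaw ν N) = ∫ θ, N θ * g (Real.log (N θ)) ∂ν := by
  rw [tiltedLogLaw, integral_map (by fun_prop) hg.aestronglyMeasurable,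
    integral_withDensity_eq_integral_toReal_smul (by fun_prop)
      (Eventually.of_forall fun _ => ENNReal.ofReal_lt_top)]
  refine integral_congr_ae (Eventually.of_forall fun θ => ?_)
  simp [ENNReal.toReal_ofReal (hN0 θ)]

lemma integrable_tiltedLogLaw (hN : Measurable N) (hN0 : ∀ θ, 0 ≤ N θ) {g : ℝ → ℝ}
    (hg : Measurable g) (hi : Integrable (fun θ => N θ * g (Real.log (N θ))) ν) :
    Integrable g (tiltedLogLaw ν N) := by
  rw [tiltedLogLaw, integrable_map_measure hg.aestronglyMeasurable (by fun_prop),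
    integrable_withDensity_iff_integrable_smul' (by fun_prop)
      (Eventually.of_forall fun _ => ENNReal.ofReal_lt_top)]
  refine hi.congr (Eventually.of_forall fun θ => ?_)
  simp [ENNReal.toReal_ofReal (hN0 θ)]

lemma tiltedLogLaw_nonarithmetic (hN : Measurable N) (hN0 : ∀ θ, 0 ≤ N θ)
    (hnonar : ∀ c : ℝ, 0 < ν {θ | N θ ≠ 0 ∧ ∀ k : ℤ, Real.log (N θ) ≠ c * k}) (c : ℝ) :
    0 < tiltedLogLaw ν N {ξ | ∀ k : ℤ, ξ ≠ c * k} := by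
  have hmeas : MeasurableSet {ξ : ℝ | ∀ k : ℤ, ξ ≠ c * k} := by
    have : {ξ : ℝ | ∀ k : ℤ, ξ ≠ c * k} = (range fun k : ℤ => c * (k : ℝ))ᶜ := by
      ext ξ; simp [eq_comm]
    rw [this]
    exact (countable_range _).measurableSet.compl
  rw [tiltedLogLaw, Measure.map_apply (by fun_prop) hmeas, pos_iff_ne_zero, Ne,
    withDensity_apply_eq_zero (by fun_prop)]
  refine (lt_of_lt_of_le (hnonar c) (measure_mono ?_)).ne'
  rintro θ ⟨h1, h2⟩
  exact ⟨by simpa using lt_of_le_of_ne (hN0 θ) (Ne.symm h1), h2⟩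

end Tilted

section ImplicitRenewal

variable {E Θ : Type*} [MeasurableSpace E] [MeasurableSpace Θ]

/-- **Implicit renewal theorem** for a stochastic fixed-point equation `U =_d V`, where `V` is close
to `N * U` with `N` independent of `U`, normalised to tail index one. -/
theorem implicit_renewal {π : Measure E} {ν : Measure Θ} [IsProbabilityMeasure π]
    [IsProbabilityMeasure ν] {U : E → ℝ} {N : Θ → ℝ} {V : E × Θ → ℝ}
    (hU : Measurable U) (hN : Measurable N) (hV : Measurable V)
    (hU0 : ∀ x, 0 ≤ U x) (hN0 : ∀ θ, 0 ≤ N θ) (hV0 : ∀ q, 0 ≤ V q)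
    (hN1 : ∫ θ, N θ ∂ν = 1)
    (hlog : Integrable (fun θ => N θ * Real.log (N θ)) ν)
    (hnonar : ∀ c : ℝ, 0 < ν {θ | N θ ≠ 0 ∧ ∀ k : ℤ, Real.log (N θ) ≠ c * k})
    (hlaw : (π.prod ν).map V = π.map U)
    (hint : Integrable (fun q : E × Θ => V q - N q.2 * U q.1) (π.prod ν)) :
    Tendsto (fun t => t * π.real {x | t < U x}) atTop
      (nhds ((∫ q : E × Θ, (V q - N q.2 * U q.1) ∂(π.prod ν)) /
        ∫ θ, N θ * Real.log (N θ) ∂ν)) := by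
  have hNi : Integrable N ν := by
    by_contra h; rw [integral_undef h] at hN1; exact zero_ne_one hN1
  have hne : 0 < ν {θ | N θ ≠ 1} := by
    refine (hnonar 0).trans_le (measure_mono ?_)
    rintro θ ⟨-, h2⟩ h
    exact h2 0 (by rw [h]; simp)
  have hmean := integral_mul_log_pos hN0 hN1 hlog hne
  set J : ℝ → ℝ := fun x => ∫ e, min (U e) (Real.exp x) ∂π with hJdef
  set H : ℝ → ℝ := fun t => π.real {x | t < U x} with hHdef
  have hmeasH : ∀ t, MeasurableSet {x | t < U x} := fun t => measurableSet_lt measurable_const hU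
  have hminU : ∀ x, Integrable (fun e => min (U e) (Real.exp x)) π := fun x => by
    refine Integrable.of_bound (by fun_prop) (Real.exp x) (Eventually.of_forall fun e => ?_)
    rw [Real.norm_of_nonneg (le_min (hU0 e) (Real.exp_pos x).le)]
    exact min_le_right _ _
  have hminV : ∀ x, Integrable (fun q => min (V q) (Real.exp x)) (π.prod ν) := fun x => by
    refine Integrable.of_bound (by fun_prop) (Real.exp x) (Eventually.of_forall fun e => ?_)
    rw [Real.norm_of_nonneg (le_min (hV0 e) (Real.exp_pos x).le)]
    exact min_le_right _ _
  have hNU0 : ∀ q : E × Θ, 0 ≤ N q.2 * U q.1 := fun q => mul_nonneg (hN0 _) (hU0 _)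
  have hminNU : ∀ x, Integrable (fun q : E × Θ => min (N q.2 * U q.1) (Real.exp x))
      (π.prod ν) := fun x => by
    refine Integrable.of_bound (by fun_prop) (Real.exp x) (Eventually.of_forall fun e => ?_)
    rw [Real.norm_of_nonneg (le_min (hNU0 e) (Real.exp_pos x).le)]
    exact min_le_right _ _
  have hJup : ∀ x y, x ≤ y → J y - J x ≤ (Real.exp y - Real.exp x) * H (Real.exp x) := by
    intro x y hxy
    have hexp := Real.exp_le_exp.2 hxy
    rw [hJdef]
    simp only
    rw [← integral_sub (hminU y) (hminU x)]
    calc _ ≤ ∫ e, {e | Real.exp x < U e}.indicator (fun _ => Real.exp y - Real.exp x) e ∂π := by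
          refine integral_mono ((hminU y).sub (hminU x))
            ((integrable_const _).indicator (hmeasH _)) fun e => ?_
          by_cases h : Real.exp x < U e
          · rw [indicator_of_mem (by exact h)]
            simp only
            rw [min_eq_right h.le]
            linarith [min_le_right (U e) (Real.exp y)]
          · rw [indicator_of_notMem (by exact h)]
            push Not at h
            simp only
            rw [min_eq_left h, min_eq_left (h.trans hexp), sub_self]
      _ = _ := by
          rw [integral_indicator (hmeasH _), setIntegral_const, smul_eq_mul, mul_comm]
  have hJlow : ∀ x y, x ≤ y → (Real.exp y - Real.exp x) * H (Real.exp y) ≤ J y - J x := by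
    intro x y hxy
    have hexp := Real.exp_le_exp.2 hxy
    rw [hJdef]
    simp only
    rw [← integral_sub (hminU y) (hminU x)]
    calc _ = ∫ e, {e | Real.exp y < U e}.indicator (fun _ => Real.exp y - Real.exp x) e ∂π := by
          rw [integral_indicator (hmeasH _), setIntegral_const, smul_eq_mul, mul_comm]
      _ ≤ _ := by
          refine integral_mono ((integrable_const _).indicator (hmeasH _))
            ((hminU y).sub (hminU x)) fun e => ?_
          by_cases h : Real.exp y < U e
          · rw [indicator_of_mem (by exact h)]
            simp only
            rw [min_eq_right h.le, min_eq_right (hexp.trans h.le)]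
          · rw [indicator_of_notMem (by exact h)]
            simp only
            exact sub_nonneg.2 (min_le_min_left _ hexp)
  have hmono : Monotone J := fun x y hxy => by
    have := hJlow x y hxy
    have h2 : 0 ≤ (Real.exp y - Real.exp x) * H (Real.exp y) :=
      mul_nonneg (sub_nonneg.2 (Real.exp_le_exp.2 hxy)) measureReal_nonneg
    linarith
  -- the renewal equation
  have hJV : ∀ x, J x = ∫ q, min (V q) (Real.exp x) ∂(π.prod ν) := fun x => by
    have h1 := integral_map (μ := π.prod ν) hV.aemeasurable
      (f := fun u : ℝ => min u (Real.exp x)) (by fun_prop)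
    have h2 := integral_map (μ := π) hU.aemeasurable
      (f := fun u : ℝ => min u (Real.exp x)) (by fun_prop)
    rw [← h1, hlaw, h2]
  have hFJ : ∀ x, ∫ ξ, J (x - ξ) ∂(tiltedLogLaw ν N) =
      ∫ q : E × Θ, min (N q.2 * U q.1) (Real.exp x) ∂(π.prod ν) := fun x => by
    rw [integral_tiltedLogLaw hN hN0 (g := fun ξ => J (x - ξ))
        (hmono.measurable.comp (measurable_const.sub measurable_id)),
      integral_prod_symm _ (hminNU x)]
    refine integral_congr_ae (Eventually.of_forall fun θ => ?_)
    simp only [hJdef]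
    rw [← integral_const_mul]
    refine integral_congr_ae (Eventually.of_forall fun e => ?_)
    rcases (hN0 θ).eq_or_lt with h | h
    · simp only [← h, zero_mul]
      rw [min_eq_left (Real.exp_pos x).le]
    · simp only
      rw [mul_min_of_nonneg _ _ h.le, Real.exp_sub, Real.exp_log h, mul_div_cancel₀ _ h.ne']
  set D : ℝ := ∫ q : E × Θ, (V q - N q.2 * U q.1) ∂(π.prod ν) with hD
  set D₁ : ℝ := ∫ q : E × Θ, |V q - N q.2 * U q.1| ∂(π.prod ν) with hD₁
  have hD₁0 : 0 ≤ D₁ := integral_nonneg fun _ => abs_nonneg _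
  have hmin_le : ∀ x (q : E × Θ), |min (V q) (Real.exp x) - min (N q.2 * U q.1) (Real.exp x)| ≤
      |V q - N q.2 * U q.1| := fun x q => by
    have := abs_min_sub_min_le_max (V q) (Real.exp x) (N q.2 * U q.1) (Real.exp x)
    simpa using this
  have hdiff : ∀ x, J x - ∫ ξ, J (x - ξ) ∂(tiltedLogLaw ν N) =
      ∫ q : E × Θ, (min (V q) (Real.exp x) - min (N q.2 * U q.1) (Real.exp x)) ∂(π.prod ν) :=
    fun x => by rw [hFJ, hJV, integral_sub (hminV x) (hminNU x)]
  have hlimD : Tendsto (fun x => J x - ∫ ξ, J (x - ξ) ∂(tiltedLogLaw ν N)) atTop (nhds D) := by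
    simp only [hdiff]
    refine tendsto_integral_filter_of_dominated_convergence (fun q => |V q - N q.2 * U q.1|)
      (Eventually.of_forall fun x => by fun_prop)
      (Eventually.of_forall fun x => Eventually.of_forall fun q => hmin_le x q) hint.abs
      (Eventually.of_forall fun q => ?_)
    refine tendsto_const_nhds.congr' ?_
    filter_upwards [Real.tendsto_exp_atTop.eventually (eventually_ge_atTop (V q)),
      Real.tendsto_exp_atTop.eventually (eventually_ge_atTop (N q.2 * U q.1))] with x h1 h2
    rw [min_eq_left h1, min_eq_left h2]
  -- the tail is of order `1 / t`
  obtain ⟨m, hm0, hm1, hm⟩ := exists_lt_one_measure_le_pos hN1 hne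
  have hmeasm : MeasurableSet {θ | N θ ≤ m} := measurableSet_le hN measurable_const
  set p : ℝ := ν.real {θ | N θ ≤ m} with hp
  have hp0 : 0 < p := ENNReal.toReal_pos hm.ne' (measure_ne_top _ _)
  set q : ℝ := (1 + m) / (2 * m) with hq
  have hq1 : 1 < q := by rw [hq, one_lt_div (by positivity)]; linarith
  have hqm : m * q = (1 + m) / 2 := by rw [hq]; field_simp
  set c : ℝ := (1 - m) / 2 * p with hc
  have hc0 : 0 < c := by apply mul_pos _ hp0; linarith
  have hblock : ∀ t > 0, t * (H t - H (q * t)) ≤ D₁ / c := by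
    intro t ht
    have hexp : Real.exp (Real.log t) = t := Real.exp_log ht
    have hGint : ∀ u, 0 ≤ u → Integrable (fun θ => min (N θ * u) t) ν := fun u hu => by
      refine Integrable.of_bound (by fun_prop) t (Eventually.of_forall fun θ => ?_)
      rw [Real.norm_of_nonneg (le_min (mul_nonneg (hN0 θ) hu) ht.le)]
      exact min_le_right _ _
    have hG : ∀ u, 0 ≤ u → ∫ θ, min (N θ * u) t ∂ν ≤ min u t := fun u hu => by
      refine le_min ?_ ?_
      · calc _ ≤ ∫ θ, N θ * u ∂ν :=
              integral_mono (hGint u hu) (hNi.mul_const u) fun θ => min_le_left _ _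
          _ = u := by rw [integral_mul_const, hN1, one_mul]
      · calc _ ≤ ∫ θ, t ∂ν := integral_mono (hGint u hu) (integrable_const _)
                fun θ => min_le_right _ _
          _ = t := by simp
    have hG' : ∀ u, t < u → u ≤ q * t → ∫ θ, min (N θ * u) t ∂ν ≤ t - c * t := fun u hu hut => by
      calc _ ≤ ∫ θ, (t - {θ | N θ ≤ m}.indicator (fun _ => (1 - m) / 2 * t) θ) ∂ν := by
            refine integral_mono (hGint u (by linarith)) ((integrable_const _).sub
              ((integrable_const _).indicator hmeasm)) fun θ => ?_
            by_cases h : N θ ≤ m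
            · simp only
              rw [indicator_of_mem (by exact h)]
              refine (min_le_left _ _).trans ?_
              calc N θ * u ≤ m * (q * t) := by gcongr; linarith
                _ = _ := by rw [← mul_assoc, hqm]; ring
            · simp only
              rw [indicator_of_notMem (by exact h), sub_zero]
              exact min_le_right _ _
        _ = _ := by
            rw [integral_sub (integrable_const _) ((integrable_const _).indicator hmeasm),
              integral_indicator hmeasm, setIntegral_const]
            simp only [integral_const, probReal_univ, smul_eq_mul, one_mul]
            rw [hc]; ring
    have hblk : MeasurableSet {e | t < U e ∧ U e ≤ q * t} :=
      (hmeasH t).inter (measurableSet_le hU measurable_const)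
    have h1 : c * t * π.real {e | t < U e ∧ U e ≤ q * t} ≤ D₁ := by
      have hGG : Integrable (fun e => ∫ θ, min (N θ * U e) t ∂ν) π := by
        have := (hminNU (Real.log t)).integral_prod_left
        simpa only [hexp] using this
      have hmU : Integrable (fun e => min (U e) t) π := by simpa only [hexp] using hminU (Real.log t)
      calc c * t * π.real {e | t < U e ∧ U e ≤ q * t}
          = ∫ e, {e | t < U e ∧ U e ≤ q * t}.indicator (fun _ => c * t) e ∂π := by
            rw [integral_indicator hblk, setIntegral_const, smul_eq_mul, mul_comm]
        _ ≤ ∫ e, (min (U e) t - ∫ θ, min (N θ * U e) t ∂ν) ∂π := by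
            refine integral_mono ((integrable_const _).indicator hblk) (hmU.sub hGG) fun e => ?_
            by_cases h : t < U e ∧ U e ≤ q * t
            · rw [indicator_of_mem (by exact h)]
              have := hG' (U e) h.1 h.2
              simp only
              rw [min_eq_right h.1.le]
              linarith
            · rw [indicator_of_notMem (by exact h)]
              exact sub_nonneg.2 (hG _ (hU0 e))
        _ = J (Real.log t) - ∫ ξ, J (Real.log t - ξ) ∂(tiltedLogLaw ν N) := by
            rw [integral_sub hmU hGG, hFJ, integral_prod _ (hminNU _), hJdef]
            simp only [hexp]
        _ ≤ D₁ := by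
            rw [hdiff]
            exact integral_mono ((hminV _).sub (hminNU _)) hint.abs fun q =>
              (le_abs_self _).trans (hmin_le _ q)
    have h2 : H t - H (q * t) = π.real {e | t < U e ∧ U e ≤ q * t} := by
      have h3 : {e | t < U e ∧ U e ≤ q * t} = {e | t < U e} \ {e | q * t < U e} := by
        ext e; simp
      rw [h3, measureReal_sdiff (fun e he => ?_) (hmeasH _)]
      exact lt_of_le_of_lt (le_mul_of_one_le_left ht.le hq1.le) he
    rw [h2, le_div_iff₀ hc0]
    linarith
  have hH0 : Tendsto H atTop (nhds 0) := by
    have := Measure.isProbabilityMeasure_map (μ := π) hU.aemeasurable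
    have h := (tendsto_cdf_atTop (π.map U)).const_sub 1
    rw [sub_self] at h
    refine h.congr fun t => ?_
    have h3 : {x | t < U x} = (U ⁻¹' (Iic t))ᶜ := by ext; simp
    rw [cdf_eq_real, map_measureReal_apply hU measurableSet_Iic, hHdef]
    simp only
    rw [h3, probReal_compl_eq_one_sub (hU measurableSet_Iic)]
  set C : ℝ := D₁ / c / (1 - q⁻¹)
  have hC0 : 0 ≤ C := div_nonneg (div_nonneg hD₁0 hc0.le)
    (by have := inv_lt_one_of_one_lt₀ hq1; linarith)
  have htail : ∀ t > 0, t * H t ≤ C := fun t ht =>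
    mul_tail_le_of_block_le hq1 (div_nonneg hD₁0 hc0.le) hH0 hblock ht
  have hLip : ∀ x y, |J x - J y| ≤ 2 * C * |x - y| := by
    refine abs_sub_le_of_le_exp hmono (fun x y hxy => (hJup x y hxy).trans ?_) hC0
    have h1 := htail (Real.exp x) (Real.exp_pos x)
    have h2 : 0 ≤ Real.exp (y - x) - 1 := by
      rw [sub_nonneg, Real.one_le_exp_iff]; linarith
    calc _ = (Real.exp x * H (Real.exp x)) * (Real.exp (y - x) - 1) := by
          rw [Real.exp_sub]; have := (Real.exp_pos x).ne'; field_simp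
      _ ≤ _ := by gcongr
  have : IsProbabilityMeasure (tiltedLogLaw ν N) := isProbabilityMeasure_tiltedLogLaw hN hN0 hN1
  have hmeanF := integral_tiltedLogLaw (ν := ν) hN hN0 measurable_id
  simp only [id] at hmeanF
  rw [← hmeanF]
  refine tendsto_tail_of_increment hJup hJlow fun a => tendsto_increment_of_renewal hLip
    (integrable_tiltedLogLaw hN hN0 measurable_id hlog) hlimD (by rw [hmeanF]; exact hmean.ne')
    (tiltedLogLaw_nonarithmetic hN hN0 hnonar) a

end ImplicitRenewal

section RandomIteration

variable {Θ : Type*} [MeasurableSpace Θ]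

/-- A sequence of iid variables is split into its first entry and an independent sequence with
the same law. -/
lemma measurePreserving_head_tail (ν : Measure Θ) [IsProbabilityMeasure ν] :
    MeasurePreserving (fun ω : ℕ → Θ => (ω 0, fun k => ω (k + 1)))
      (Measure.infinitePi fun _ : ℕ => ν) (ν.prod (Measure.infinitePi fun _ : ℕ => ν)) := by
  have hm : Measurable fun ω : ℕ → Θ => (ω 0, fun k => ω (k + 1)) := by fun_prop
  refine ⟨hm, ?_⟩
  set P := Measure.infinitePi fun _ : ℕ => ν
  let cons : Θ × (ℕ → Θ) → ℕ → Θ := fun q n => Nat.casesOn n q.1 fun k => q.2 k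
  have hc : Measurable cons := by
    refine measurable_pi_lambda _ fun n => ?_
    cases n with
    | zero => exact measurable_fst
    | succ k => exact (measurable_pi_apply k).comp measurable_snd
  have hcons : (ν.prod P).map cons = P := by
    refine Measure.eq_infinitePi _ fun s t ht => ?_
    classical
    obtain ⟨N, hN⟩ := s.exists_nat_subset_range
    let t' : ℕ → Set Θ := fun i => if i ∈ s then t i else univ
    have ht' : ∀ i, MeasurableSet (t' i) := fun i => by
      by_cases h : i ∈ s <;> simp [t', h, ht]
    have h1 : Set.pi (s : Set ℕ) t = Set.pi (Finset.range (N + 1) : Set ℕ) t' := by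
      ext ω
      simp only [Set.mem_pi, Finset.mem_coe]
      constructor
      · intro h i _
        by_cases hi : i ∈ s
        · simpa [t', hi] using h i hi
        · simp [t', hi]
      · intro h i hi
        have := h i (Finset.range_mono N.le_succ (hN hi))
        simpa [t', hi] using this
    have h2 : ∏ i ∈ s, ν (t i) = ∏ i ∈ Finset.range (N + 1), ν (t' i) := by
      rw [← Finset.prod_subset (hN.trans (Finset.range_mono N.le_succ))]
      · exact Finset.prod_congr rfl fun i hi => by simp [t', hi]
      · intro i _ hi
        simp [t', hi]
    have h3 : cons ⁻¹' Set.pi (Finset.range (N + 1) : Set ℕ) t' =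
        t' 0 ×ˢ Set.pi (Finset.range N : Set ℕ) fun i => t' (i + 1) := by
      ext q
      simp only [Set.mem_preimage, Set.mem_pi, Finset.mem_coe, Finset.mem_range, Set.mem_prod]
      constructor
      · exact fun h => ⟨h 0 N.succ_pos, fun i hi => h (i + 1) (by omega)⟩
      · rintro ⟨h0, h⟩ (_ | i) hi
        · exact h0
        · exact h i (by omega)
    rw [h1, h2, Measure.map_apply hc (MeasurableSet.pi (Finset.countable_toSet _) fun i _ => ht' i),
      h3, Measure.prod_prod, Measure.infinitePi_pi _ fun i _ => ht' (i + 1),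
      Finset.prod_range_succ', mul_comm]
  conv_lhs => rw [← hcons]
  rw [Measure.map_map hm hc]
  exact Measure.map_id

/-- Backward iteration `w (ω 0) ∘ w (ω 1) ∘ ⋯ ∘ w (ω (n - 1))` of a random map. -/
def backwardIterate (w : Θ → ℝ → ℝ) : ℕ → (ℕ → Θ) → ℝ → ℝ
  | 0, _, x => x
  | n + 1, ω, x => w (ω 0) (backwardIterate w n (fun k => ω (k + 1)) x)

variable {ν : Measure Θ} [IsProbabilityMeasure ν] {w : Θ → ℝ → ℝ}

lemma measurable_backwardIterate (hw : Measurable (Function.uncurry w)) (n : ℕ) :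
    Measurable fun q : (ℕ → Θ) × ℝ => backwardIterate w n q.1 q.2 := by
  induction n with
  | zero => exact measurable_snd
  | succ n ih =>
    have h : Measurable fun q : (ℕ → Θ) × ℝ => ((fun k => q.1 (k + 1) : ℕ → Θ), q.2) := by fun_prop
    have h0 : Measurable fun q : (ℕ → Θ) × ℝ => q.1 0 := by fun_prop
    exact hw.comp (h0.prodMk (ih.comp h))

lemma lintegral_contraction (hw : Measurable (Function.uncurry w)) {L : Θ → ℝ} (hL : Measurable L)
    (hLip : ∀ θ x y, |w θ x - w θ y| ≤ L θ * |x - y|) {s : ℝ} (hs : 0 ≤ s)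
    {F G : (ℕ → Θ) → ℝ} (hF : Measurable F) (hG : Measurable G) :
    ∫⁻ ω, ‖w (ω 0) (F fun k => ω (k + 1)) - w (ω 0) (G fun k => ω (k + 1))‖ₑ ^ s
        ∂(Measure.infinitePi fun _ : ℕ => ν) ≤
      (∫⁻ θ, ‖L θ‖ₑ ^ s ∂ν) * ∫⁻ ω, ‖F ω - G ω‖ₑ ^ s ∂(Measure.infinitePi fun _ : ℕ => ν) := by
  have hm : Measurable fun q : Θ × (ℕ → Θ) => ‖w q.1 (F q.2) - w q.1 (G q.2)‖ₑ ^ s := by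
    have h1 : Measurable fun q : Θ × (ℕ → Θ) => w q.1 (F q.2) :=
      hw.comp (measurable_fst.prodMk (hF.comp measurable_snd))
    have h2 : Measurable fun q : Θ × (ℕ → Θ) => w q.1 (G q.2) :=
      hw.comp (measurable_fst.prodMk (hG.comp measurable_snd))
    exact (h1.sub h2).enorm.pow_const s
  rw [(measurePreserving_head_tail ν).lintegral_comp hm]
  calc _ ≤ ∫⁻ q, ‖L q.1‖ₑ ^ s * ‖F q.2 - G q.2‖ₑ ^ s
        ∂(ν.prod (Measure.infinitePi fun _ : ℕ => ν)) := by
        refine lintegral_mono fun q => ?_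
        rw [← ENNReal.mul_rpow_of_nonneg _ _ hs, ← enorm_mul]
        refine ENNReal.rpow_le_rpow (enorm_le_iff_norm_le.2 ?_) hs
        rw [norm_mul, Real.norm_eq_abs, Real.norm_eq_abs, Real.norm_eq_abs]
        exact (hLip _ _ _).trans (by gcongr; exact le_abs_self _)
    _ = _ := lintegral_prod_mul (hL.enorm.pow_const s).aemeasurable
        ((hF.sub hG).enorm.pow_const s).aemeasurable

lemma summable_abs_of_tsum_lintegral {Ω : Type*} [MeasurableSpace Ω] {P : Measure Ω} {s : ℝ}
    (hs : 0 < s) (hs1 : s ≤ 1) {f : ℕ → Ω → ℝ} (hf : ∀ n, Measurable (f n))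
    (h : ∑' n, ∫⁻ ω, ‖f n ω‖ₑ ^ s ∂P ≠ ⊤) : ∀ᵐ ω ∂P, Summable fun n => |f n ω| := by
  rw [← lintegral_tsum fun n => ((hf n).enorm.pow_const s).aemeasurable] at h
  filter_upwards [ae_lt_top' (by fun_prop) h] with ω hω
  have h1 : Summable fun n => |f n ω| ^ s := by
    have := ENNReal.summable_toReal hω.ne
    refine this.congr fun n => ?_
    rw [← ENNReal.toReal_rpow, toReal_enorm, Real.norm_eq_abs]
  have h2 : ∀ᶠ n in atTop, |f n ω| ^ s < 1 := h1.tendsto_atTop_zero.eventually_lt_const one_pos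
  refine h1.of_norm_bounded_eventually_nat ?_
  filter_upwards [h2] with n hn
  rw [Real.norm_eq_abs, abs_abs]
  have h3 : |f n ω| < 1 := by
    by_contra! h
    exact absurd (Real.one_le_rpow h hs.le) (not_le.2 hn)
  rcases (abs_nonneg (f n ω)).eq_or_lt with h0 | h0
  · rw [← h0]; positivity
  · simpa using Real.rpow_le_rpow_of_exponent_ge h0 h3.le hs1

/-- The law of the almost sure limit of the backward iterates of a contracting random map is the
unique stationary law. -/
theorem exists_unique_stationary (hw : Measurable (Function.uncurry w)) {L : Θ → ℝ}
    (hL : Measurable L) (hLip : ∀ θ x y, |w θ x - w θ y| ≤ L θ * |x - y|) {s : ℝ} (hs : 0 < s)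
    (hs1 : s ≤ 1) (hρ : ∫⁻ θ, ‖L θ‖ₑ ^ s ∂ν < 1) (h0 : ∫⁻ θ, ‖w θ 0‖ₑ ^ s ∂ν ≠ ⊤) :
    ∃ π : Measure ℝ, IsProbabilityMeasure π ∧
      (π.prod ν).map (fun q => w q.2 q.1) = π ∧
      (∀ π' : Measure ℝ, IsProbabilityMeasure π' →
        (π'.prod ν).map (fun q => w q.2 q.1) = π' → π' = π) ∧
      ∀ (p : ℝ) (r b : ENNReal), 0 < p → r < 1 → b ≠ ⊤ →
        (∀ x, ∫⁻ θ, ‖w θ x‖ₑ ^ p ∂ν ≤ r * ‖x‖ₑ ^ p + b) → ∫⁻ x, ‖x‖ₑ ^ p ∂π ≠ ⊤ := by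
  set P := Measure.infinitePi fun _ : ℕ => ν with hP
  set ρ := ∫⁻ θ, ‖L θ‖ₑ ^ s ∂ν
  have hmp := measurePreserving_head_tail ν
  have hY := measurable_backwardIterate hw
  have hYx : ∀ x n, Measurable fun ω => backwardIterate w n ω x := fun x n =>
    (hY n).comp (measurable_id.prodMk measurable_const)
  have hwc : ∀ θ, Continuous (w θ) := fun θ =>
    (LipschitzWith.of_dist_le_mul (K := ‖L θ‖₊) fun x y => by
      simpa [Real.dist_eq] using (hLip θ x y).trans (by gcongr; exact le_abs_self _)).continuous
  have hgeo : ∀ (C : ENNReal), C ≠ ⊤ → ∑' n, ρ ^ n * C ≠ ⊤ := fun C hC => by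
    rw [ENNReal.tsum_mul_right, ENNReal.tsum_geometric]
    exact ENNReal.mul_ne_top (ENNReal.inv_ne_top.2 (tsub_pos_of_lt hρ).ne') hC
  have hd : ∀ n, ∫⁻ ω, ‖backwardIterate w (n + 1) ω 0 - backwardIterate w n ω 0‖ₑ ^ s ∂P ≤
      ρ ^ n * ∫⁻ θ, ‖w θ 0‖ₑ ^ s ∂ν := by
    intro n
    induction n with
    | zero =>
      have := hmp.lintegral_comp (f := fun q : Θ × (ℕ → Θ) => ‖w q.1 0‖ₑ ^ s)
        (((hw.comp (measurable_fst.prodMk measurable_const)).enorm).pow_const s)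
      simp only [backwardIterate, sub_zero, pow_zero, one_mul]
      rw [this, lintegral_prod _ (by
        exact (((hw.comp (measurable_fst.prodMk measurable_const)).enorm).pow_const s).aemeasurable)]
      simp
    | succ n ih =>
      refine (lintegral_contraction hw hL hLip hs.le (hYx 0 (n + 1)) (hYx 0 n)).trans ?_
      rw [pow_succ', mul_assoc]
      gcongr
  have hd' : ∀ x n, ∫⁻ ω, ‖backwardIterate w n ω x - backwardIterate w n ω 0‖ₑ ^ s ∂P ≤
      ρ ^ n * ‖x‖ₑ ^ s := by
    intro x n
    induction n with
    | zero => simp [backwardIterate]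
    | succ n ih =>
      refine (lintegral_contraction hw hL hLip hs.le (hYx x n) (hYx 0 n)).trans ?_
      rw [pow_succ', mul_assoc]
      gcongr
  have hlim : ∀ᵐ ω ∂P, ∃ l, Tendsto (fun n => backwardIterate w n ω 0) atTop (nhds l) := by
    filter_upwards [summable_abs_of_tsum_lintegral hs hs1 (fun n => (hYx 0 (n + 1)).sub (hYx 0 n))
      (ne_top_of_le_ne_top (hgeo _ h0) (ENNReal.tsum_le_tsum hd))] with ω hω
    refine cauchySeq_tendsto_of_complete (cauchySeq_of_summable_dist (hω.congr fun n => ?_))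
    rw [dist_comm, Real.dist_eq]
    rfl
  obtain ⟨X, hX, hXlim⟩ := measurable_limit_of_tendsto_metrizable_ae
    (fun n => (hYx 0 n).aemeasurable) hlim
  have hXlim' : ∀ x, ∀ᵐ ω ∂P, Tendsto (fun n => backwardIterate w n ω x) atTop (nhds (X ω)) := by
    intro x
    filter_upwards [hXlim, summable_abs_of_tsum_lintegral hs hs1
      (fun n => (hYx x n).sub (hYx 0 n))
      (ne_top_of_le_ne_top (hgeo (‖x‖ₑ ^ s) (by finiteness)) (ENNReal.tsum_le_tsum (hd' x)))]
      with ω h1 h2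
    have h3 := (tendsto_zero_iff_abs_tendsto_zero _).2 h2.tendsto_atTop_zero
    simpa using h3.add h1
  have hXeq : ∀ᵐ ω ∂P, X ω = w (ω 0) (X fun k => ω (k + 1)) := by
    have htail : Measure.QuasiMeasurePreserving (fun (ω : ℕ → Θ) k => ω (k + 1)) P P :=
      Measure.quasiMeasurePreserving_snd.comp hmp.quasiMeasurePreserving
    filter_upwards [hXlim, htail.ae hXlim] with ω h1 h2
    refine tendsto_nhds_unique ((tendsto_add_atTop_iff_nat 1).2 h1) ?_
    exact ((hwc (ω 0)).tendsto _).comp h2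
  have hπ : IsProbabilityMeasure (P.map X) := Measure.isProbabilityMeasure_map hX.aemeasurable
  refine ⟨P.map X, hπ, ?_, ?_, ?_⟩
  · have hid : MeasurePreserving (id : Θ → Θ) ν ν := MeasurePreserving.id ν
    have h1 := ((hid.prod (hX.measurePreserving P)).comp hmp)
    have h2 := Measure.measurePreserving_swap.comp h1
    have hwm : Measurable fun q : ℝ × Θ => w q.2 q.1 := hw.comp measurable_swap
    rw [← h2.map_eq, Measure.map_map hwm h2.measurable]
    exact Measure.map_congr (hXeq.mono fun ω h => h.symm)
  · intro π' _ hst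
    have hstat : MeasurePreserving (fun q : Θ × ℝ => w q.1 q.2) (ν.prod π') π' := by
      refine ⟨hw, ?_⟩
      conv_rhs => rw [← hst]
      rw [← Measure.prod_swap]
      exact Measure.map_map hw measurable_swap
    have hlaw : ∀ n, MeasurePreserving (fun q : (ℕ → Θ) × ℝ => backwardIterate w n q.1 q.2)
        (P.prod π') π' := by
      intro n
      induction n with
      | zero => exact measurePreserving_snd
      | succ n ih =>
        have h1 := hmp.prod (MeasurePreserving.id π')
        have h2 := (MeasureTheory.measurePreserving_prodAssoc ν P π').comp h1
        exact hstat.comp (((MeasurePreserving.id ν).prod ih).comp h2)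
    refine ext_of_forall_integral_eq_of_IsFiniteMeasure fun f => ?_
    have hb : ∀ x, ‖f x‖ ≤ ‖f‖ := f.norm_coe_le_norm
    have hfc := f.continuous
    have hXm : AEStronglyMeasurable (fun q : (ℕ → Θ) × ℝ => f (X q.1)) (P.prod π') :=
      (hfc.measurable.comp (hX.comp measurable_fst)).aestronglyMeasurable
    have h1 : ∀ n, ∫ x, f x ∂π' = ∫ q, f (backwardIterate w n q.1 q.2) ∂(P.prod π') := fun n => by
      conv_lhs => rw [← (hlaw n).map_eq]
      exact integral_map (hY n).aemeasurable hfc.aestronglyMeasurable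
    have hae : ∀ᵐ q ∂(P.prod π'),
        Tendsto (fun n => f (backwardIterate w n q.1 q.2)) atTop (nhds (f (X q.1))) := by
      have hms : MeasurableSet {q : ℝ × (ℕ → Θ) |
          Tendsto (fun n => f (backwardIterate w n q.2 q.1)) atTop (nhds (f (X q.2)))} :=
        measurableSet_tendsto_fun
          (fun n => hfc.measurable.comp ((hY n).comp measurable_swap))
          (hfc.measurable.comp (hX.comp measurable_snd))
      have := (Measure.ae_prod_iff_ae_ae hms).2 (Eventually.of_forall fun x =>
        (hXlim' x).mono fun ω h => (hfc.tendsto _).comp h : ∀ᵐ x ∂π', ∀ᵐ ω ∂P, _)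
      exact (Measure.measurePreserving_swap (μ := P) (ν := π')).quasiMeasurePreserving.ae this
    have h2 := tendsto_integral_of_dominated_convergence (fun _ => ‖f‖)
      (fun n => (hfc.measurable.comp (hY n)).aestronglyMeasurable) (integrable_const _)
      (fun n => Eventually.of_forall fun q => hb _) hae
    have h3 : ∫ q, f (X q.1) ∂(P.prod π') = ∫ x, f x ∂(P.map X) := by
      rw [integral_map hX.aemeasurable hfc.aestronglyMeasurable,
        integral_fun_fst (fun ω => f (X ω))]
      simp
    rw [← h3]
    exact tendsto_nhds_unique (tendsto_const_nhds.congr h1) h2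
  · intro p r b hp hr hb hdrift
    have hbound : ∀ n, ∫⁻ ω, ‖backwardIterate w n ω 0‖ₑ ^ p ∂P ≤ b * (1 - r)⁻¹ := by
      intro n
      induction n with
      | zero => simp [backwardIterate, hp]
      | succ n ih =>
        have hm : Measurable fun q : Θ × (ℕ → Θ) => ‖w q.1 (backwardIterate w n q.2 0)‖ₑ ^ p :=
          (hw.comp (measurable_fst.prodMk ((hYx 0 n).comp measurable_snd))).enorm.pow_const p
        calc _ = ∫⁻ q, ‖w q.1 (backwardIterate w n q.2 0)‖ₑ ^ p ∂(ν.prod P) :=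
              hmp.lintegral_comp hm
          _ = ∫⁻ ω, ∫⁻ θ, ‖w θ (backwardIterate w n ω 0)‖ₑ ^ p ∂ν ∂P :=
              lintegral_prod_symm' _ hm
          _ ≤ ∫⁻ ω, (r * ‖backwardIterate w n ω 0‖ₑ ^ p + b) ∂P :=
              lintegral_mono fun ω => hdrift _
          _ = r * ∫⁻ ω, ‖backwardIterate w n ω 0‖ₑ ^ p ∂P + b := by
              rw [lintegral_add_right _ measurable_const,
                lintegral_const_mul _ ((hYx 0 n).enorm.pow_const p)]
              simp
          _ ≤ r * (b * (1 - r)⁻¹) + (1 - r) * (b * (1 - r)⁻¹) := by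
              gcongr
              rw [mul_left_comm, ENNReal.mul_inv_cancel (tsub_pos_of_lt hr).ne' (by finiteness),
                mul_one]
          _ = _ := by
              rw [← add_mul, add_tsub_cancel_of_le hr.le, one_mul]
    rw [lintegral_map (by fun_prop) hX]
    refine ne_top_of_le_ne_top (b := b * (1 - r)⁻¹)
      (ENNReal.mul_ne_top hb (ENNReal.inv_ne_top.2 (tsub_pos_of_lt hr).ne')) ?_
    calc ∫⁻ ω, ‖X ω‖ₑ ^ p ∂P = ∫⁻ ω, liminf (fun n => ‖backwardIterate w n ω 0‖ₑ ^ p) atTop ∂P := by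
          refine lintegral_congr_ae (hXlim.mono fun ω h => ?_)
          have hc : Continuous fun x : ℝ => ‖x‖ₑ ^ p :=
            ENNReal.continuous_rpow_const.comp continuous_enorm
          exact (((hc.tendsto _).comp h).liminf_eq).symm
      _ ≤ liminf (fun n => ∫⁻ ω, ‖backwardIterate w n ω 0‖ₑ ^ p ∂P) atTop :=
          lintegral_liminf_le fun n => (hYx 0 n).enorm.pow_const p
      _ ≤ _ := liminf_le_of_le (by isBoundedDefault) fun c hc => by
          obtain ⟨n, hn⟩ := hc.exists
          exact hn.trans (hbound n)

end RandomIteration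

section Moments

variable {Θ : Type*} [MeasurableSpace Θ] {ν : Measure Θ} [IsProbabilityMeasure ν]

/-- If the mean of `h` is negative, possibly `-∞`, then so is that of a truncation of `h`. -/
lemma exists_integral_max_neg {h : Θ → ℝ} (hm : Measurable h)
    (hpos : Integrable (fun θ => max (h θ) 0) ν)
    (hneg : (∫ θ, h θ ∂ν) < 0 ∨ ¬ Integrable h ν) :
    ∃ N : ℕ, ∫ θ, max (h θ) (-(N : ℝ)) ∂ν < 0 := by
  by_contra! hcon
  have hbd : ∀ (N : ℕ) θ, |max (h θ) (-(N : ℝ))| ≤ max (h θ) 0 + N := fun N θ => by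
    have : (0 : ℝ) ≤ N := N.cast_nonneg
    rcases le_total (h θ) (-(N : ℝ)) with h1 | h1 <;> rcases le_total (h θ) 0 with h2 | h2 <;>
      simp only [h1, h2, max_eq_left, max_eq_right] <;> rw [abs_le] <;> constructor <;> linarith
  have hint : ∀ N : ℕ, Integrable (fun θ => max (h θ) (-(N : ℝ))) ν := fun N =>
    (hpos.add (integrable_const (N : ℝ))).mono' (by fun_prop)
      (Eventually.of_forall fun θ => hbd N θ)
  have hlim : ∀ θ, Tendsto (fun N : ℕ => max (h θ) (-(N : ℝ))) atTop (nhds (h θ)) := fun θ => by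
    refine tendsto_const_nhds.congr' ?_
    obtain ⟨N, hN⟩ := exists_nat_ge (-h θ)
    filter_upwards [eventually_ge_atTop N] with n hn
    have : (N : ℝ) ≤ n := by exact_mod_cast hn
    rw [max_eq_left (by linarith)]
  have hhint : Integrable h ν := by
    refine ⟨hm.aestronglyMeasurable, ?_⟩
    have h1 : ∀ N : ℕ, ∫⁻ θ, ‖max (h θ) (-(N : ℝ))‖ₑ ∂ν ≤
        ENNReal.ofReal (2 * ∫ θ, max (h θ) 0 ∂ν) := fun N => by
      rw [← ofReal_integral_norm_eq_lintegral_enorm (hint N)]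
      refine ENNReal.ofReal_le_ofReal ?_
      have h2 : ∫ θ, ‖max (h θ) (-(N : ℝ))‖ ∂ν ≤
          ∫ θ, (2 * max (h θ) 0 - max (h θ) (-(N : ℝ))) ∂ν := by
        refine integral_mono (hint N).norm ((hpos.const_mul 2).sub (hint N)) fun θ => ?_
        have : (0 : ℝ) ≤ N := N.cast_nonneg
        simp only [Real.norm_eq_abs]
        rcases le_total (h θ) (-(N : ℝ)) with h1 | h1 <;> rcases le_total (h θ) 0 with h2 | h2 <;>
          simp only [h1, h2, max_eq_left, max_eq_right] <;> rw [abs_le] <;> constructor <;> linarith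
      rw [integral_sub (hpos.const_mul 2) (hint N), integral_const_mul] at h2
      linarith [hcon N]
    calc ∫⁻ θ, ‖h θ‖ₑ ∂ν
        = ∫⁻ θ, liminf (fun N : ℕ => ‖max (h θ) (-(N : ℝ))‖ₑ) atTop ∂ν :=
          lintegral_congr fun θ => ((hlim θ).enorm.liminf_eq).symm
      _ ≤ liminf (fun N : ℕ => ∫⁻ θ, ‖max (h θ) (-(N : ℝ))‖ₑ ∂ν) atTop :=
          lintegral_liminf_le fun N => by fun_prop
      _ ≤ ENNReal.ofReal (2 * ∫ θ, max (h θ) 0 ∂ν) :=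
          liminf_le_of_le (by isBoundedDefault) fun c hc => by
            obtain ⟨n, hn⟩ := hc.exists
            exact hn.trans (h1 n)
      _ < ⊤ := ENNReal.ofReal_lt_top
  have h0 : (∫ θ, h θ ∂ν) < 0 := hneg.resolve_right (not_not.2 hhint)
  have h1 : Tendsto (fun N : ℕ => ∫ θ, max (h θ) (-(N : ℝ)) ∂ν) atTop (nhds (∫ θ, h θ ∂ν)) := by
    refine tendsto_integral_of_dominated_convergence (fun θ => |h θ|)
      (fun N => by fun_prop) hhint.abs (fun N => Eventually.of_forall fun θ => ?_)
      (Eventually.of_forall hlim)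
    have : (0 : ℝ) ≤ N := N.cast_nonneg
    rw [Real.norm_eq_abs]
    rcases le_total (h θ) (-(N : ℝ)) with h1 | h1
    · rw [max_eq_right h1, abs_of_nonpos (by linarith), abs_of_nonpos (by linarith)]; linarith
    · rw [max_eq_left h1]
  exact absurd (ge_of_tendsto' h1 hcon) (not_le.2 h0)

/-- A positive variable with negative logarithmic mean and a finite moment has small moments
below one. -/
lemma exists_rpow_integral_lt_one {L : Θ → ℝ} (hL : Measurable L) (hL0 : ∀ θ, 0 ≤ L θ) {p : ℝ}
    (hp : 0 < p) (hLp : Integrable (fun θ => L θ ^ p) ν)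
    (hpos : Integrable (fun θ => max (Real.log (L θ)) 0) ν)
    (hneg : (∫ θ, Real.log (L θ) ∂ν) < 0 ∨ ¬ Integrable (fun θ => Real.log (L θ)) ν) :
    ∃ s, 0 < s ∧ s ≤ 1 ∧ s ≤ p ∧ ∫⁻ θ, ‖L θ‖ₑ ^ s ∂ν < 1 := by
  obtain ⟨N, hN⟩ := exists_integral_max_neg hL.log hpos hneg
  set X : Θ → ℝ := fun θ => Real.log (max (L θ) (Real.exp (-(N : ℝ)))) with hX
  have hN0 : (0 : ℝ) ≤ N := N.cast_nonneg
  have hLN : ∀ θ, 0 < max (L θ) (Real.exp (-(N : ℝ))) := fun θ =>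
    lt_max_of_lt_right (Real.exp_pos _)
  have hXm : Measurable X := (hL.max measurable_const).log
  have hexpX : ∀ t θ, Real.exp (t * X θ) = max (L θ) (Real.exp (-(N : ℝ))) ^ t := fun t θ => by
    rw [Real.rpow_def_of_pos (hLN θ), mul_comm]
  have hXN : ∀ θ, -(N : ℝ) ≤ X θ := fun θ => by
    rw [Real.le_log_iff_exp_le (hLN θ)]; exact le_max_right _ _
  have hXle : ∀ θ, X θ ≤ max (Real.log (L θ)) (-(N : ℝ)) := fun θ => by
    simp only [hX]
    rcases le_total (L θ) (Real.exp (-(N : ℝ))) with h | h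
    · rw [max_eq_right h, Real.log_exp]; exact le_max_right _ _
    · rw [max_eq_left h]; exact le_max_left _ _
  have hXp : Integrable (fun θ => Real.exp (p * X θ)) ν := by
    refine (hLp.add (integrable_const (1 : ℝ))).mono' (by fun_prop)
      (Eventually.of_forall fun θ => ?_)
    rw [Real.norm_eq_abs, Real.abs_exp, hexpX]
    have h1 : Real.exp (-(N : ℝ)) ≤ 1 := Real.exp_le_one_iff.2 (by linarith)
    have h2 : 0 ≤ L θ ^ p := Real.rpow_nonneg (hL0 θ) p
    rcases le_total (L θ) (Real.exp (-(N : ℝ))) with h | h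
    · rw [max_eq_right h]
      exact (Real.rpow_le_one (Real.exp_pos _).le h1 hp.le).trans (by simpa using h2)
    · rw [max_eq_left h]; simp
  have hXp' : Integrable (fun θ => Real.exp (-p * X θ)) ν := by
    refine (integrable_const (Real.exp (p * N))).mono' (by fun_prop)
      (Eventually.of_forall fun θ => ?_)
    rw [Real.norm_eq_abs, Real.abs_exp, Real.exp_le_exp]
    nlinarith [hXN θ]
  have h0mem : (0 : ℝ) ∈ interior (integrableExpSet X ν) := by
    refine interior_mono (s := Ioo (-p) p) (fun t ht => ?_) ?_
    · exact integrable_exp_mul_of_le_of_le hXp' hXp ht.1.le ht.2.le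
    · rw [interior_Ioo]; exact ⟨by linarith, hp⟩
  have hder := hasDerivAt_mgf h0mem
  simp only [zero_mul, Real.exp_zero, mul_one] at hder
  have hXint : Integrable X ν := by
    exact (memLp_one_iff_integrable).1 (by
      simpa using memLp_of_mem_interior_integrableExpSet h0mem 1)
  have hmean : ν[X] < 0 := by
    refine (integral_mono hXint ?_ hXle).trans_lt hN
    by_contra h
    rw [integral_undef h] at hN
    exact lt_irrefl _ hN
  have hev := hder.tendsto_slope_zero_right.eventually_lt_const hmean
  obtain ⟨s, hs, hs0, hsp, hs1⟩ := (hev.and ((eventually_mem_nhdsWithin).and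
    ((eventually_nhdsWithin_of_eventually_nhds (eventually_lt_nhds hp)).and
      (eventually_nhdsWithin_of_eventually_nhds (eventually_lt_nhds one_pos))))).exists
  replace hs0 : 0 < s := hs0
  have hmgf : mgf X ν s < 1 := by
    rw [zero_add, mgf_zero, smul_eq_mul, inv_mul_lt_iff₀ hs0, mul_zero] at hs
    linarith
  refine ⟨s, hs0, hs1.le, hsp.le, ?_⟩
  have hXs : Integrable (fun θ => Real.exp (s * X θ)) ν :=
    integrable_exp_mul_of_le_of_le hXp' hXp (by linarith) hsp.le
  calc ∫⁻ θ, ‖L θ‖ₑ ^ s ∂ν ≤ ∫⁻ θ, ENNReal.ofReal (Real.exp (s * X θ)) ∂ν := by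
        refine lintegral_mono fun θ => ?_
        rw [hexpX, Real.enorm_of_nonneg (hL0 θ), ENNReal.ofReal_rpow_of_nonneg (hL0 θ) hs0.le]
        exact ENNReal.ofReal_le_ofReal
          (Real.rpow_le_rpow (hL0 θ) (le_max_left _ _) hs0.le)
    _ = ENNReal.ofReal (mgf X ν s) := by
        rw [← ofReal_integral_eq_lintegral_ofReal hXs
          (Eventually.of_forall fun θ => (Real.exp_pos _).le), mgf]
    _ < 1 := by rwa [ENNReal.ofReal_lt_one]

/-- Strict Lyapunov inequality between the moments of a nonnegative variable of mean one. -/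
lemma integral_rpow_lt_one {N : Θ → ℝ} (hN : Measurable N) (hN0 : ∀ θ, 0 ≤ N θ)
    (hN1 : ∫ θ, N θ ∂ν = 1) (hne : 0 < ν {θ | N θ ≠ 1}) {r : ℝ} (hr : 0 < r) (hr1 : r < 1) :
    Integrable (fun θ => N θ ^ r) ν ∧ ∫ θ, N θ ^ r ∂ν < 1 := by
  have hNint : Integrable N ν := by
    by_contra h; rw [integral_undef h] at hN1; exact zero_ne_one hN1
  have hlt : ∀ θ, N θ ≠ 1 → N θ ^ r < 1 + r * (N θ - 1) := fun θ h => by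
    have := rpow_one_add_lt_one_add_mul_self (s := N θ - 1) (by linarith [hN0 θ])
      (sub_ne_zero.2 h) hr hr1
    simpa using this
  have hle : ∀ θ, N θ ^ r ≤ 1 + r * (N θ - 1) := fun θ => by
    by_cases h : N θ = 1
    · simp [h]
    · exact (hlt θ h).le
  have hsub : Integrable (fun θ => N θ - 1) ν := hNint.sub (integrable_const _)
  have hint' : Integrable (fun θ => 1 + r * (N θ - 1)) ν :=
    (integrable_const _).add (hsub.const_mul r)
  have hint : Integrable (fun θ => N θ ^ r) ν :=
    hint'.mono' (hN.pow_const r).aestronglyMeasurable (Eventually.of_forall fun θ => by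
      rw [Real.norm_eq_abs, abs_of_nonneg (Real.rpow_nonneg (hN0 θ) r)]; exact hle θ)
  refine ⟨hint, ?_⟩
  have h1 : ∫ θ, (1 + r * (N θ - 1)) ∂ν = 1 := by
    rw [integral_add (integrable_const _) (hsub.const_mul r),
      integral_const_mul, integral_sub hNint (integrable_const _), hN1]
    simp
  rw [← h1, ← sub_pos, ← integral_sub hint' hint]
  refine (integral_pos_iff_support_of_nonneg (fun θ => sub_nonneg.2 (hle θ))
    (hint'.sub hint)).2 (hne.trans_le (measure_mono fun θ h => ?_))
  exact (sub_pos.2 (hlt θ h)).ne'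

end Moments

section Arch

/-- One step of the AR(1) chain with ARCH(1) errors, from `x` with innovation `e`. -/
def archStep (α β lam e x : ℝ) : ℝ := α * x + Real.sqrt (β + lam * x ^ 2) * e

variable {α β lam : ℝ}

lemma measurable_archStep (α β lam : ℝ) :
    Measurable (Function.uncurry (archStep α β lam)) := by
  unfold archStep Function.uncurry
  fun_prop

lemma archStep_neg_neg (e x : ℝ) : archStep α β lam (-e) (-x) = -archStep α β lam e x := by
  simp only [archStep, neg_sq]; ring

lemma sqrt_add_mul_sq_le (hβ : 0 ≤ β) (hlam : 0 ≤ lam) (x y : ℝ) :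
    Real.sqrt (β + lam * x ^ 2) ≤ Real.sqrt (β + lam * y ^ 2) + Real.sqrt lam * |x - y| := by
  have h0 : 0 ≤ β + lam * y ^ 2 := by positivity
  refine Real.sqrt_le_iff.2 ⟨by positivity, ?_⟩
  have h1 := Real.sq_sqrt h0
  have h2 := Real.sq_sqrt hlam
  have h3 : Real.sqrt lam * |y| ≤ Real.sqrt (β + lam * y ^ 2) := by
    refine Real.le_sqrt_of_sq_le ?_
    rw [mul_pow, h2, sq_abs]; linarith
  have h4 : lam * (y * (x - y)) ≤ Real.sqrt lam * |x - y| * Real.sqrt (β + lam * y ^ 2) := by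
    calc lam * (y * (x - y)) ≤ lam * (|y| * |x - y|) := by
          rw [← abs_mul]; exact mul_le_mul_of_nonneg_left (le_abs_self _) hlam
      _ = Real.sqrt lam * |x - y| * (Real.sqrt lam * |y|) := by
          nth_rewrite 1 [← h2]; ring
      _ ≤ _ := by gcongr
  have h5 : (Real.sqrt lam * |x - y|) ^ 2 = lam * (x - y) ^ 2 := by rw [mul_pow, h2, sq_abs]
  nlinarith

lemma archStep_lipschitz (hα : 0 ≤ α) (hβ : 0 ≤ β) (hlam : 0 ≤ lam) (e x y : ℝ) :
    |archStep α β lam e x - archStep α β lam e y| ≤ (α + Real.sqrt lam * |e|) * |x - y| := by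
  have h1 : |Real.sqrt (β + lam * x ^ 2) - Real.sqrt (β + lam * y ^ 2)| ≤
      Real.sqrt lam * |x - y| := by
    rw [abs_sub_le_iff]
    have h2 := sqrt_add_mul_sq_le hβ hlam x y
    have h3 := sqrt_add_mul_sq_le hβ hlam y x
    rw [abs_sub_comm y x] at h3
    exact ⟨by linarith, by linarith⟩
  calc |archStep α β lam e x - archStep α β lam e y|
      = |α * (x - y) + (Real.sqrt (β + lam * x ^ 2) - Real.sqrt (β + lam * y ^ 2)) * e| := by
        simp only [archStep]; congr 1; ring
    _ ≤ α * |x - y| + |Real.sqrt (β + lam * x ^ 2) - Real.sqrt (β + lam * y ^ 2)| * |e| := by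
        refine (abs_add_le _ _).trans ?_
        rw [abs_mul, abs_mul, abs_of_nonneg hα]
    _ ≤ α * |x - y| + Real.sqrt lam * |x - y| * |e| := by gcongr
    _ = _ := by ring

lemma abs_archStep_sub_le (hβ : 0 ≤ β) (hlam : 0 ≤ lam) (e : ℝ) {y : ℝ} (hy : 0 ≤ y) :
    |archStep α β lam e y - (α + Real.sqrt lam * e) * y| ≤ Real.sqrt β * |e| := by
  have h1 : Real.sqrt (β + lam * y ^ 2) ≤ Real.sqrt β + Real.sqrt lam * y := by
    simpa [abs_of_nonneg hy] using sqrt_add_mul_sq_le hβ hlam y 0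
  have h2 : Real.sqrt lam * y ≤ Real.sqrt (β + lam * y ^ 2) := by
    refine Real.le_sqrt_of_sq_le ?_
    rw [mul_pow, Real.sq_sqrt hlam]; linarith
  calc _ = |(Real.sqrt (β + lam * y ^ 2) - Real.sqrt lam * y) * e| := by
        simp only [archStep]; congr 1; ring
    _ = (Real.sqrt (β + lam * y ^ 2) - Real.sqrt lam * y) * |e| := by
        rw [abs_mul, abs_of_nonneg (sub_nonneg.2 h2)]
    _ ≤ _ := by gcongr; linarith

lemma mul_le_archStep (hβ : 0 ≤ β) (hlam : 0 ≤ lam) {e : ℝ} (he : 0 ≤ e) (y : ℝ) :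
    (α + Real.sqrt lam * e) * y ≤ archStep α β lam e y := by
  have h2 : Real.sqrt lam * y ≤ Real.sqrt (β + lam * y ^ 2) := by
    refine Real.le_sqrt_of_sq_le ?_
    rw [mul_pow, Real.sq_sqrt hlam]; linarith
  simp only [archStep]
  nlinarith

/-- The square of the chain as a function of the previous squared state. -/
lemma sq_archStep_abs (hβ : 0 < β) (hlam : 0 ≤ lam) (e x : ℝ) :
    (α + Real.sqrt lam * e) ^ 2 * x ^ 2 +
        2 * α * β * e * Real.sqrt (x ^ 2) /
          (Real.sqrt (β + lam * x ^ 2) + Real.sqrt (lam * x ^ 2)) + β * e ^ 2 =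
      archStep α β lam e |x| ^ 2 := by
  have h0 : 0 < β + lam * x ^ 2 := by positivity
  have h1 := Real.sq_sqrt h0.le
  have h2 := Real.sq_sqrt hlam
  have h3 : 0 < Real.sqrt (β + lam * x ^ 2) := Real.sqrt_pos.2 h0
  have h4 : Real.sqrt (lam * x ^ 2) = Real.sqrt lam * |x| := by
    rw [Real.sqrt_mul hlam, Real.sqrt_sq_eq_abs]
  have h5 : 0 ≤ Real.sqrt lam * |x| := by positivity
  have h6 : |x| ^ 2 = x ^ 2 := sq_abs x
  rw [h4, Real.sqrt_sq_eq_abs, archStep, h6]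
  set S := Real.sqrt (β + lam * x ^ 2)
  set l := Real.sqrt lam
  set y := |x|
  have h7 : S + l * y ≠ 0 := by positivity
  rw [← h6] at h1 ⊢
  rw [← h2] at h1
  field_simp
  have h8 : β = S ^ 2 - l ^ 2 * y ^ 2 := by linarith
  rw [h8]
  ring

lemma integral_comp_neg_of_symm {ν : Measure ℝ} (hsymm : ν.map (fun x : ℝ => -x) = ν) (f : ℝ → ℝ) :
    ∫ e, f (-e) ∂ν = ∫ e, f e ∂ν := by
  conv_rhs => rw [← hsymm]
  exact ((MeasurableEquiv.neg ℝ).measurableEmbedding.integral_map f).symm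

lemma integrable_comp_neg_of_symm {ν : Measure ℝ} (hsymm : ν.map (fun x : ℝ => -x) = ν) {f : ℝ → ℝ}
    (hf : Integrable f ν) : Integrable (fun e => f (-e)) ν := by
  rw [← hsymm] at hf
  exact ((MeasurableEquiv.neg ℝ).measurableEmbedding.integrable_map_iff).1 hf

variable {ν : Measure ℝ} [IsProbabilityMeasure ν]

lemma integrable_abs_rpow_of_affine {p : ℝ} (hp : 0 < p) (hlam : 0 < lam)
    (h : Integrable (fun e => |α + Real.sqrt lam * e| ^ p) ν) :
    MemLp (fun e : ℝ => e) (ENNReal.ofReal p) ν := by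
  have hl : Real.sqrt lam ≠ 0 := (Real.sqrt_pos.2 hlam).ne'
  have h1 : MemLp (fun e => α + Real.sqrt lam * e) (ENNReal.ofReal p) ν := by
    rw [← integrable_norm_rpow_iff (by fun_prop) (by simpa using hp) ENNReal.ofReal_ne_top,
      ENNReal.toReal_ofReal hp.le]
    exact h
  have h2 := (h1.sub (memLp_const α)).const_mul (Real.sqrt lam)⁻¹
  refine (memLp_congr_ae (Eventually.of_forall fun e => ?_)).1 h2
  simp [hl]

lemma integrable_affine_abs_rpow {p : ℝ} (hp : 0 < p)
    (h : MemLp (fun e : ℝ => e) (ENNReal.ofReal p) ν) {a c : ℝ} (ha : 0 ≤ a) (hc : 0 ≤ c) :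
    Integrable (fun e => (a + c * |e|) ^ p) ν := by
  have h1 : MemLp (fun e => a + c * |e|) (ENNReal.ofReal p) ν :=
    (memLp_const a).add (h.abs.const_mul c)
  have := (integrable_norm_rpow_iff (by fun_prop) (by simpa using hp) ENNReal.ofReal_ne_top).2 h1
  rw [ENNReal.toReal_ofReal hp.le] at this
  refine this.congr (Eventually.of_forall fun e => ?_)
  have : 0 ≤ a + c * |e| := by positivity
  simp only [Real.norm_eq_abs, abs_of_nonneg this]

lemma add_rpow_le_of_pos {a c δ q : ℝ} (ha : 0 ≤ a) (hc : 0 ≤ c) (hδ : 0 < δ) (hq : 0 ≤ q) :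
    (a + c) ^ q ≤ (1 + δ) ^ q * a ^ q + ((1 + δ⁻¹) * c) ^ q := by
  rw [← Real.mul_rpow (by positivity) ha]
  have h1 : 0 ≤ ((1 + δ) * a) ^ q := by positivity
  have h2 : 0 ≤ ((1 + δ⁻¹) * c) ^ q := by positivity
  rcases le_total c (δ * a) with h | h
  · have : (a + c) ^ q ≤ ((1 + δ) * a) ^ q := by gcongr; linarith
    linarith
  · have : (a + c) ^ q ≤ ((1 + δ⁻¹) * c) ^ q := by
      gcongr
      have : a ≤ δ⁻¹ * c := by
        rw [inv_mul_eq_div, le_div_iff₀ hδ]; linarith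
      linarith
    linarith

/-- Geometric drift condition for moments of order below the tail index. -/
lemma archStep_drift (hβ : 0 < β) (hlam : 0 < lam) (hsymm : ν.map (fun x : ℝ => -x) = ν)
    {q : ℝ} (hq : 0 < q) (hA : Integrable (fun e => |α + Real.sqrt lam * e| ^ q) ν)
    (hA1 : ∫ e, |α + Real.sqrt lam * e| ^ q ∂ν < 1) :
    ∃ r b : ℝ, 0 ≤ r ∧ r < 1 ∧ 0 ≤ b ∧ ∀ x, Integrable (fun e => |archStep α β lam e x| ^ q) ν ∧
      ∫ e, |archStep α β lam e x| ^ q ∂ν ≤ r * |x| ^ q + b := by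
  have hlim : Tendsto (fun δ : ℝ => (1 + δ) ^ q * ∫ e, |α + Real.sqrt lam * e| ^ q ∂ν)
      (nhdsWithin 0 (Ioi 0)) (nhds (∫ e, |α + Real.sqrt lam * e| ^ q ∂ν)) := by
    have : ContinuousAt (fun δ : ℝ => (1 + δ) ^ q * ∫ e, |α + Real.sqrt lam * e| ^ q ∂ν) 0 :=
      (ContinuousAt.rpow_const (by fun_prop) (Or.inl (by norm_num))).mul continuousAt_const
    have h := this.tendsto
    simp only [add_zero, Real.one_rpow, one_mul] at h
    exact h.mono_left nhdsWithin_le_nhds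
  obtain ⟨δ, hδ1, hδ⟩ := ((hlim.eventually_lt_const hA1).and eventually_mem_nhdsWithin).exists
  replace hδ : 0 < δ := hδ
  have hB : Integrable (fun e => (0 + (1 + δ⁻¹) * Real.sqrt β * |e|) ^ q) ν :=
    integrable_affine_abs_rpow hq (integrable_abs_rpow_of_affine hq hlam hA) le_rfl (by positivity)
  refine ⟨_, ∫ e, (0 + (1 + δ⁻¹) * Real.sqrt β * |e|) ^ q ∂ν, by positivity, hδ1,
    integral_nonneg fun e => by positivity, ?_⟩
  have hpt : ∀ y, 0 ≤ y → ∀ e, |archStep α β lam e y| ^ q ≤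
      ((1 + δ) ^ q * |α + Real.sqrt lam * e| ^ q) * y ^ q +
        (0 + (1 + δ⁻¹) * Real.sqrt β * |e|) ^ q := by
    intro y hy e
    have h1 : |archStep α β lam e y| ≤ |α + Real.sqrt lam * e| * y + Real.sqrt β * |e| := by
      have h2 := abs_archStep_sub_le (α := α) hβ.le hlam.le e hy
      have h3 := abs_sub_abs_le_abs_sub (archStep α β lam e y) ((α + Real.sqrt lam * e) * y)
      rw [abs_mul, abs_of_nonneg hy] at h3
      linarith
    calc _ ≤ (|α + Real.sqrt lam * e| * y + Real.sqrt β * |e|) ^ q := by gcongr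
      _ ≤ _ := add_rpow_le_of_pos (by positivity) (by positivity) hδ hq.le
      _ = _ := by rw [Real.mul_rpow (abs_nonneg _) hy]; ring_nf
  have hnn : ∀ y, 0 ≤ y → Integrable (fun e => |archStep α β lam e y| ^ q) ν ∧
      ∫ e, |archStep α β lam e y| ^ q ∂ν ≤
        (1 + δ) ^ q * (∫ e, |α + Real.sqrt lam * e| ^ q ∂ν) * |y| ^ q +
          ∫ e, (0 + (1 + δ⁻¹) * Real.sqrt β * |e|) ^ q ∂ν := by
    intro y hy
    have hi := (hA.const_mul ((1 + δ) ^ q)).mul_const (y ^ q)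
    have hm : Measurable fun e => |archStep α β lam e y| ^ q :=
      ((measurable_archStep α β lam).comp (measurable_id.prodMk measurable_const)).abs.pow_const q
    have hint : Integrable (fun e => |archStep α β lam e y| ^ q) ν :=
      (hi.add hB).mono' hm.aestronglyMeasurable (Eventually.of_forall fun e => by
        rw [Real.norm_eq_abs, abs_of_nonneg (by positivity)]; exact hpt y hy e)
    refine ⟨hint, (integral_mono hint (hi.add hB) (hpt y hy)).trans (le_of_eq ?_)⟩
    refine (integral_add hi hB).trans ?_
    rw [ integral_mul_const, integral_const_mul, abs_of_nonneg hy]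
  intro x
  rcases le_total 0 x with hx | hx
  · exact hnn x hx
  · have h := hnn (-x) (by linarith)
    have heq : (fun e => |archStep α β lam e x| ^ q) =
        fun e => (fun e => |archStep α β lam e (-x)| ^ q) (-e) := by
      funext e
      simp only [archStep_neg_neg, abs_neg]
    rw [heq, integral_comp_neg_of_symm hsymm fun e => |archStep α β lam e (-x)| ^ q]
    exact ⟨integrable_comp_neg_of_symm hsymm h.1, by simpa only [abs_neg] using h.2⟩

end Arch

section ArchStationary

variable {α β lam : ℝ} {ν : Measure ℝ} [IsProbabilityMeasure ν]

lemma measure_Ioi_pos_of_symm {μ : Measure ℝ} (hsymm : μ.map (fun x : ℝ => -x) = μ)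
    (h : 0 < μ {x : ℝ | x ≠ 0}) : 0 < μ (Ioi 0) := by
  rw [pos_iff_ne_zero] at h ⊢
  intro h0
  refine h (measure_mono_null (t := Ioi 0 ∪ Iio 0) (fun x hx => ?_) (measure_union_null h0 ?_))
  · rcases lt_or_gt_of_ne hx with h | h
    · exact Or.inr h
    · exact Or.inl h
  · rw [← hsymm, Measure.map_apply measurable_neg measurableSet_Iio]
    refine measure_mono_null (fun x hx => ?_) h0
    simpa using hx

/-- A contracting ARCH chain has a unique stationary law, which is symmetric and has all moments
of order below the tail index. -/
lemma exists_stationary_archStep (hα : 0 ≤ α) (hβ : 0 < β) (hlam : 0 < lam)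
    (hsymm : ν.map (fun x : ℝ => -x) = ν)
    (hlogplus : Integrable (fun x => max (Real.log (α + Real.sqrt lam * |x|)) 0) ν)
    (hcontr : (∫ x, Real.log (α + Real.sqrt lam * |x|) ∂ν) < 0 ∨
      ¬ Integrable (fun x => Real.log (α + Real.sqrt lam * |x|)) ν)
    {p : ℝ} (hp : 0 < p) (hA : Integrable (fun e => |α + Real.sqrt lam * e| ^ p) ν)
    (hA1 : ∀ q, 0 < q → q < p → Integrable (fun e => |α + Real.sqrt lam * e| ^ q) ν ∧
      ∫ e, |α + Real.sqrt lam * e| ^ q ∂ν < 1) :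
    ∃ π : Measure ℝ, IsProbabilityMeasure π ∧
      (π.prod ν).map (fun q => archStep α β lam q.2 q.1) = π ∧
      (∀ π' : Measure ℝ, IsProbabilityMeasure π' →
        (π'.prod ν).map (fun q => archStep α β lam q.2 q.1) = π' → π' = π) ∧
      π.map (fun x : ℝ => -x) = π ∧
      ∀ q, 0 < q → q < p → Integrable (fun x : ℝ => |x| ^ q) π := by
  have hmem := integrable_abs_rpow_of_affine hp hlam hA
  have hL : Measurable fun e : ℝ => α + Real.sqrt lam * |e| := by fun_prop
  have hL0 : ∀ e : ℝ, 0 ≤ α + Real.sqrt lam * |e| := fun e => by positivity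
  obtain ⟨s, hs, hs1, hsp, hρ⟩ := exists_rpow_integral_lt_one hL hL0 hp
    (integrable_affine_abs_rpow hp hmem hα (Real.sqrt_nonneg _)) hlogplus hcontr
  have h0 : ∫⁻ e, ‖archStep α β lam e 0‖ₑ ^ s ∂ν ≠ ⊤ := by
    have h1 : MemLp (fun e : ℝ => e) (ENNReal.ofReal s) ν :=
      hmem.mono_exponent (ENNReal.ofReal_le_ofReal hsp)
    have h2 := (h1.const_mul (Real.sqrt β)).eLpNorm_lt_top
    have h3 := lintegral_rpow_enorm_lt_top_of_eLpNorm_lt_top (by simpa using hs)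
      ENNReal.ofReal_ne_top h2
    rw [ENNReal.toReal_ofReal hs.le] at h3
    simpa [archStep] using h3.ne
  obtain ⟨π, hπ, hst, huniq, hmom⟩ := exists_unique_stationary (measurable_archStep α β lam) hL
    (archStep_lipschitz hα hβ.le hlam.le) hs hs1 hρ h0
  have hm : Measurable fun q : ℝ × ℝ => archStep α β lam q.2 q.1 :=
    (measurable_archStep α β lam).comp measurable_swap
  refine ⟨π, hπ, hst, huniq, ?_, fun q hq hqp => ?_⟩
  · refine huniq _ (Measure.isProbabilityMeasure_map (by fun_prop)) ?_
    have hneg : Measurable fun x : ℝ => -x := measurable_neg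
    conv_lhs => rw [← hsymm]
    rw [Measure.map_prod_map _ _ hneg hneg, Measure.map_map hm (hneg.prodMap hneg)]
    conv_rhs => rw [← hst, Measure.map_map hneg hm]
    congr 1
    funext q
    exact archStep_neg_neg _ _
  · obtain ⟨r, b, hr0, hr1, hb, hd⟩ := archStep_drift hβ hlam hsymm hq (hA1 q hq hqp).1
      (hA1 q hq hqp).2
    have h1 := hmom q (ENNReal.ofReal r) (ENNReal.ofReal b) hq (by simpa using hr1)
      ENNReal.ofReal_ne_top fun x => by
        have h2 : ∀ y : ℝ, ‖y‖ₑ ^ q = ENNReal.ofReal (|y| ^ q) := fun y => by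
          rw [← ENNReal.ofReal_rpow_of_nonneg (abs_nonneg _) hq.le, ← Real.norm_eq_abs,
            ofReal_norm]
        simp only [h2]
        rw [← ofReal_integral_eq_lintegral_ofReal (hd x).1
          (Eventually.of_forall fun e => by positivity), ← ENNReal.ofReal_mul hr0,
          ← ENNReal.ofReal_add (by positivity) hb]
        exact ENNReal.ofReal_le_ofReal (hd x).2
    refine ⟨(measurable_norm.pow_const q).aestronglyMeasurable, ?_⟩
    have h2 : ∀ y : ℝ, ‖|y| ^ q‖ₑ = ‖y‖ₑ ^ q := fun y => by
      rw [Real.enorm_rpow_of_nonneg (abs_nonneg _) hq.le, ← Real.norm_eq_abs, enorm_norm]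
    rw [hasFiniteIntegral_iff_enorm]
    simp only [h2]
    exact lt_top_iff_ne_top.2 h1

variable {π : Measure ℝ} [IsProbabilityMeasure π]

/-- The absolute value of the stationary chain is itself a stationary chain. -/
lemma map_abs_archStep (hsymm : ν.map (fun x : ℝ => -x) = ν)
    (hst : (π.prod ν).map (fun q => archStep α β lam q.2 q.1) = π) :
    (π.prod ν).map (fun q => |archStep α β lam q.2 (|q.1|)|) = π.map fun x => |x| := by
  have hg : Measurable (Function.uncurry fun x e : ℝ => if 0 ≤ x then e else -e) :=
    Measurable.ite (measurableSet_le measurable_const measurable_fst) measurable_snd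
      measurable_snd.neg
  have hT := (MeasurePreserving.id π).skew_product (μc := ν) (μd := ν) hg
    (Eventually.of_forall fun x => by
      by_cases hx : 0 ≤ x
      · simp only [hx, if_true]; exact Measure.map_id
      · simp only [hx, if_false]; exact hsymm)
  have hm : Measurable fun q : ℝ × ℝ => archStep α β lam q.2 q.1 :=
    (measurable_archStep α β lam).comp measurable_swap
  have hm' : Measurable fun q : ℝ × ℝ => |archStep α β lam q.2 (|q.1|)| :=
    ((measurable_archStep α β lam).comp (measurable_snd.prodMk measurable_fst.abs)).abs
  rw [← hT.map_eq, Measure.map_map hm' hT.measurable]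
  conv_rhs => rw [← hst]
  rw [Measure.map_map (by fun_prop) hm]
  congr 1
  funext q
  simp only [Function.comp, id]
  by_cases hx : 0 ≤ q.1
  · simp only [hx, if_true, abs_of_nonneg hx]
  · simp only [hx, if_false, abs_of_neg (not_le.1 hx), archStep_neg_neg, abs_neg]

/-- The stationary law is unbounded above. -/
lemma measure_Ioi_pos_of_stationary (hβ : 0 < β) (hlam : 0 < lam)
    (hsymm : ν.map (fun x : ℝ => -x) = ν) (hnontriv : 0 < ν {x : ℝ | x ≠ 0})
    (hα : 0 ≤ α) (hgt : 0 < ν {e | 1 < |α + Real.sqrt lam * e|})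
    (hπsymm : π.map (fun x : ℝ => -x) = π)
    (hst : (π.prod ν).map (fun q => archStep α β lam q.2 q.1) = π) (R : ℝ) :
    0 < π (Ioi R) := by
  have hm : Measurable fun q : ℝ × ℝ => archStep α β lam q.2 q.1 :=
    (measurable_archStep α β lam).comp measurable_swap
  have hstep : ∀ (a c : Set ℝ) (t : ℝ), 0 < π a → 0 < ν c →
      (∀ x ∈ a, ∀ e ∈ c, t < archStep α β lam e x) → 0 < π (Ioi t) := by
    intro a c t ha hc h
    rw [← hst, Measure.map_apply hm measurableSet_Ioi]
    refine lt_of_lt_of_le (ENNReal.mul_pos ha.ne' hc.ne') ?_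
    rw [← Measure.prod_prod]
    exact measure_mono fun q hq => h _ hq.1 _ hq.2
  have hpos : 0 < ν {e | 0 ≤ e ∧ 1 < α + Real.sqrt lam * e} := by
    have hms : MeasurableSet {e : ℝ | 0 ≤ e ∧ 1 < α + Real.sqrt lam * e} :=
      (measurableSet_le measurable_const measurable_id).inter
        (measurableSet_lt measurable_const
          (measurable_const.add (measurable_const.mul measurable_id)))
    by_contra h0
    rw [not_lt, nonpos_iff_eq_zero] at h0
    refine hgt.ne' (measure_mono_null (t := {e : ℝ | 0 ≤ e ∧ 1 < α + Real.sqrt lam * e} ∪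
      (fun x : ℝ => -x) ⁻¹' {e : ℝ | 0 ≤ e ∧ 1 < α + Real.sqrt lam * e}) (fun e he => ?_)
      (measure_union_null h0 ?_))
    · have h1 : |α + Real.sqrt lam * e| ≤ α + Real.sqrt lam * |e| := by
        refine (abs_add_le _ _).trans ?_
        rw [abs_mul, abs_of_nonneg hα, abs_of_nonneg (Real.sqrt_nonneg _)]
      have h2 : 1 < α + Real.sqrt lam * |e| := lt_of_lt_of_le he h1
      rcases le_total 0 e with h | h
      · exact Or.inl ⟨h, by rwa [abs_of_nonneg h] at h2⟩
      · exact Or.inr ⟨by simpa using h, by rwa [abs_of_nonpos h] at h2⟩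
    · rw [← Measure.map_apply measurable_neg hms, hsymm, h0]
  obtain ⟨δ, hδ, hδpos⟩ : ∃ δ : ℝ, 0 < δ ∧ 0 < ν {e | 0 ≤ e ∧ 1 + δ < α + Real.sqrt lam * e} := by
    have hU : {e | 0 ≤ e ∧ 1 < α + Real.sqrt lam * e} ⊆
        ⋃ n : ℕ, {e | 0 ≤ e ∧ 1 + 1 / ((n : ℝ) + 1) < α + Real.sqrt lam * e} := by
      intro e he
      obtain ⟨n, hn⟩ := exists_nat_one_div_lt (sub_pos.2 he.2)
      exact mem_iUnion.2 ⟨n, he.1, by linarith⟩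
    obtain ⟨n, hn⟩ := exists_measure_pos_of_not_measure_iUnion_null
      (hpos.trans_le (measure_mono hU)).ne'
    exact ⟨_, Nat.one_div_pos_of_nat, hn⟩
  have hπ0 : 0 < π (Ioi 0) := by
    by_cases h0 : π {x : ℝ | x ≠ 0} = 0
    · have h1 : π {0} ≠ 0 := by
        intro h1
        have : π univ = 0 := by
          rw [← compl_union_self {(0 : ℝ)}]
          exact measure_union_null h0 h1
        simp at this
      refine hstep {0} (Ioi 0) 0 (pos_iff_ne_zero.2 h1) (measure_Ioi_pos_of_symm hsymm hnontriv) ?_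
      rintro x rfl e he
      replace he : 0 < e := he
      have := Real.sqrt_pos.2 hβ
      simp only [archStep, mul_zero, zero_add, ne_eq, OfNat.ofNat_ne_zero, not_false_eq_true,
        zero_pow, add_zero]
      positivity
    · exact measure_Ioi_pos_of_symm hπsymm (pos_iff_ne_zero.2 h0)
  obtain ⟨R₀, hR₀, hR₀pos⟩ : ∃ R₀ : ℝ, 0 < R₀ ∧ 0 < π (Ioi R₀) := by
    have hU : Ioi (0 : ℝ) ⊆ ⋃ n : ℕ, Ioi (1 / ((n : ℝ) + 1)) := by
      intro x hx
      obtain ⟨n, hn⟩ := exists_nat_one_div_lt (show (0 : ℝ) < x from hx)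
      exact mem_iUnion.2 ⟨n, hn⟩
    obtain ⟨n, hn⟩ := exists_measure_pos_of_not_measure_iUnion_null
      (hπ0.trans_le (measure_mono hU)).ne'
    exact ⟨_, Nat.one_div_pos_of_nat, hn⟩
  have hiter : ∀ n : ℕ, 0 < π (Ioi ((1 + δ) ^ n * R₀)) := by
    intro n
    induction n with
    | zero => simpa using hR₀pos
    | succ n ih =>
      refine hstep _ _ _ ih hδpos ?_
      intro x hx e he
      replace hx : (1 + δ) ^ n * R₀ < x := hx
      have hx0 : 0 < x := lt_trans (by positivity) hx
      calc (1 + δ) ^ (n + 1) * R₀ = (1 + δ) * ((1 + δ) ^ n * R₀) := by ring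
        _ < (1 + δ) * x := by gcongr
        _ ≤ (α + Real.sqrt lam * e) * x := mul_le_mul_of_nonneg_right he.2.le hx0.le
        _ ≤ _ := mul_le_archStep hβ.le hlam.le he.1 x
  have hlim : Tendsto (fun n : ℕ => (1 + δ) ^ n * R₀) atTop atTop :=
    (tendsto_pow_atTop_atTop_of_one_lt (by linarith)).atTop_mul_const hR₀
  obtain ⟨n, hn⟩ := (hlim.eventually_ge_atTop R).exists
  exact (hiter n).trans_le (measure_mono (Ioi_subset_Ioi hn))

end ArchStationary

section ArchGap

lemma rpow_sub_rpow_le {p u v : ℝ} (hp : 1 ≤ p) (hu : 0 ≤ u) (hv : 0 ≤ v) :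
    u ^ p - v ^ p ≤ p * |u - v| * max u v ^ (p - 1) := by
  rcases le_total u v with h | h
  · have h1 : u ^ p ≤ v ^ p := by gcongr
    have h2 : 0 ≤ p * |u - v| * max u v ^ (p - 1) := by positivity
    linarith
  · rcases hu.eq_or_lt with h0 | h0
    · have : v = 0 := le_antisymm (h.trans h0.symm.le) hv
      rw [this, ← h0]; simp
    · rw [max_eq_left h, abs_of_nonneg (sub_nonneg.2 h)]
      have h1 := one_add_mul_self_le_rpow_one_add (s := v / u - 1) (p := p)
        (by have : 0 ≤ v / u := by positivity
            linarith) hp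
      rw [add_sub_cancel, Real.div_rpow hv hu, le_div_iff₀ (by positivity)] at h1
      have h2 : u ^ p = u ^ (p - 1) * u := by
        rw [← Real.rpow_add_one h0.ne']; simp
      have h3 : (1 + p * (v / u - 1)) * u ^ p = u ^ p - p * (u - v) * u ^ (p - 1) := by
        rw [h2]; field_simp; ring
      linarith

/-- Powers of nonnegative numbers whose difference is bounded by `h` differ by at most `h ^ p`
times a power of strictly lower order. -/
lemma abs_rpow_sub_rpow_le {p u v h y : ℝ} (hp : 0 < p) (hu : 0 ≤ u) (hv : 0 ≤ v) (hh : 0 ≤ h)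
    (hy : 0 ≤ y) (huv : |u - v| ≤ h) (hum : u ≤ h * (1 + y)) (hvm : v ≤ h * (1 + y)) :
    |u ^ p - v ^ p| ≤ max p 1 * h ^ p * (1 + y) ^ max (p - 1) 0 := by
  rcases le_total p 1 with hp1 | hp1
  · have key : ∀ a b : ℝ, 0 ≤ a → 0 ≤ b → |a - b| ≤ h → a ^ p - b ^ p ≤ h ^ p := by
      intro a b ha hb hab
      have h1 : a ≤ b + h := by linarith [le_abs_self (a - b)]
      have h2 : a ^ p ≤ (b + h) ^ p := by gcongr
      linarith [Real.rpow_add_le_add_rpow hb hh hp.le hp1]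
    rw [max_eq_right hp1, max_eq_right (by linarith), Real.rpow_zero, mul_one, one_mul,
      abs_sub_le_iff]
    exact ⟨key u v hu hv huv, key v u hv hu (by rwa [abs_sub_comm])⟩
  · rw [max_eq_left hp1, max_eq_left (by linarith : 0 ≤ p - 1)]
    have h1 : p * |u - v| * max u v ^ (p - 1) ≤ p * h ^ p * (1 + y) ^ (p - 1) := by
      calc p * |u - v| * max u v ^ (p - 1) ≤ p * h * (h * (1 + y)) ^ (p - 1) := by
            gcongr
            exact max_le hum hvm
        _ = p * h ^ p * (1 + y) ^ (p - 1) := by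
            rw [Real.mul_rpow hh (by positivity)]
            rcases hh.eq_or_lt with h0 | h0
            · rw [← h0, Real.zero_rpow hp.ne']; ring
            · have : h ^ p = h ^ (p - 1) * h := by rw [← Real.rpow_add_one h0.ne']; simp
              rw [this]; ring
    rw [abs_sub_le_iff]
    refine ⟨(rpow_sub_rpow_le hp1 hu hv).trans h1, ?_⟩
    refine (rpow_sub_rpow_le hp1 hv hu).trans ?_
    rwa [abs_sub_comm, max_comm]

variable {α β lam : ℝ}

lemma abs_archStep_rpow_sub_le (hα : 0 ≤ α) (hβ : 0 ≤ β) (hlam : 0 ≤ lam) {p : ℝ} (hp : 0 < p)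
    (e : ℝ) {y : ℝ} (hy : 0 ≤ y) :
    |(|archStep α β lam e y| ^ p - |α + Real.sqrt lam * e| ^ p * y ^ p)| ≤
      max p 1 * (α + (Real.sqrt lam + Real.sqrt β) * |e|) ^ p * (1 + y) ^ max (p - 1) 0 := by
  rw [← Real.mul_rpow (abs_nonneg _) hy]
  have h1 := abs_archStep_sub_le (α := α) hβ hlam e hy
  have h2 := abs_abs_sub_abs_le (archStep α β lam e y) ((α + Real.sqrt lam * e) * y)
  rw [abs_mul _ y, abs_of_nonneg hy] at h2
  have h3 : |α + Real.sqrt lam * e| ≤ α + Real.sqrt lam * |e| := by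
    refine (abs_add_le _ _).trans ?_
    rw [abs_mul, abs_of_nonneg hα, abs_of_nonneg (Real.sqrt_nonneg _)]
  have h4 : 0 ≤ Real.sqrt lam * |e| := by positivity
  have h5 : 0 ≤ Real.sqrt β * |e| := by positivity
  have h6 : |α + Real.sqrt lam * e| * y ≤ (α + Real.sqrt lam * |e|) * y := by gcongr
  have h7 := le_abs_self (|archStep α β lam e y| - |α + Real.sqrt lam * e| * y)
  refine abs_rpow_sub_rpow_le hp (abs_nonneg _) (by positivity) (by positivity) hy ?_ ?_ ?_ <;>
    nlinarith

variable {ν π : Measure ℝ} [IsProbabilityMeasure ν] [IsProbabilityMeasure π]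

lemma integrable_one_add_abs_rpow {q : ℝ} (hq : 0 < q)
    (h : Integrable (fun x : ℝ => |x| ^ q) π) : Integrable (fun x : ℝ => (1 + |x|) ^ q) π := by
  have h1 : MemLp (fun x : ℝ => x) (ENNReal.ofReal q) π := by
    rw [← integrable_norm_rpow_iff (by fun_prop) (by simpa using hq) ENNReal.ofReal_ne_top,
      ENNReal.toReal_ofReal hq.le]
    exact h
  simpa using integrable_affine_abs_rpow hq h1 zero_le_one zero_le_one

/-- The difference of the powers of the chain and of its linear approximation is integrable, with
positive mean. -/
lemma integrable_and_integral_gap_pos (hα : 0 ≤ α) (hβ : 0 < β) (hlam : 0 < lam)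
    (hsymm : ν.map (fun x : ℝ => -x) = ν)
    (hst : (π.prod ν).map (fun q => archStep α β lam q.2 q.1) = π)
    {p : ℝ} (hp : 0 < p) (hA : Integrable (fun e => |α + Real.sqrt lam * e| ^ p) ν)
    (hAp : ∫ e, |α + Real.sqrt lam * e| ^ p ∂ν = 1)
    (hA1 : ∀ q, 0 < q → q < p → Integrable (fun e => |α + Real.sqrt lam * e| ^ q) ν ∧
      ∫ e, |α + Real.sqrt lam * e| ^ q ∂ν < 1)
    (hmom : ∀ q, 0 < q → q < p → Integrable (fun x : ℝ => |x| ^ q) π)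
    (hunb : ∀ R, 0 < π (Ioi R)) :
    Integrable (fun q : ℝ × ℝ => |archStep α β lam q.2 (|q.1|)| ^ p -
        |α + Real.sqrt lam * q.2| ^ p * |q.1| ^ p) (π.prod ν) ∧
      0 < ∫ q : ℝ × ℝ, (|archStep α β lam q.2 (|q.1|)| ^ p -
        |α + Real.sqrt lam * q.2| ^ p * |q.1| ^ p) ∂(π.prod ν) := by
  have hWm : Measurable fun q : ℝ × ℝ => |archStep α β lam q.2 (|q.1|)| :=
    ((measurable_archStep α β lam).comp (measurable_snd.prodMk measurable_fst.abs)).abs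
  have hAm : Measurable fun e : ℝ => |α + Real.sqrt lam * e| ^ p :=
    Measurable.pow_const (by fun_prop) p
  have hAm' : Measurable fun q : ℝ × ℝ => |α + Real.sqrt lam * q.2| ^ p := hAm.comp measurable_snd
  obtain ⟨q, hq1, hqp⟩ : ∃ q, max (p - 1) 0 < q ∧ q < p :=
    exists_between (max_lt (by linarith) hp)
  have hq : 0 < q := (le_max_right _ _).trans_lt hq1
  have hmem := integrable_abs_rpow_of_affine hp hlam hA
  have hh := (integrable_affine_abs_rpow hp hmem hα
    (by positivity : 0 ≤ Real.sqrt lam + Real.sqrt β)).const_mul (max p 1)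
  set k : ℝ → ℝ := fun e => max p 1 * (α + (Real.sqrt lam + Real.sqrt β) * |e|) ^ p with hk
  have hk0 : ∀ e, 0 ≤ k e := fun e => by simp only [hk]; positivity
  have hpt : ∀ (y e : ℝ), 0 ≤ y →
      |(|archStep α β lam e y| ^ p - |α + Real.sqrt lam * e| ^ p * y ^ p)| ≤
        k e * (1 + y) ^ max (p - 1) 0 := fun y e hy =>
    abs_archStep_rpow_sub_le hα hβ.le hlam.le hp e hy
  have hint : Integrable (fun q : ℝ × ℝ => |archStep α β lam q.2 (|q.1|)| ^ p -
      |α + Real.sqrt lam * q.2| ^ p * |q.1| ^ p) (π.prod ν) := by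
    have h1 := (integrable_one_add_abs_rpow hq (hmom q hq hqp)).mul_prod hh
    refine h1.mono' ((hWm.pow_const p).sub (hAm'.mul
      (measurable_fst.abs.pow_const p))).aestronglyMeasurable
      (Eventually.of_forall fun z => ?_)
    rw [Real.norm_eq_abs]
    refine ((hpt _ _ (abs_nonneg z.1)).trans ?_).trans_eq (mul_comm _ _)
    refine mul_le_mul_of_nonneg_left ?_ (hk0 _)
    exact Real.rpow_le_rpow_of_exponent_le (by linarith [abs_nonneg z.1]) hq1.le
  refine ⟨hint, ?_⟩
  obtain ⟨r, b, hr0, hr1, hb, hdrift⟩ := archStep_drift hβ hlam hsymm hq (hA1 q hq hqp).1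
    (hA1 q hq hqp).2
  set c : ℝ := ∫ e, k e ∂ν with hc
  have hc0 : 0 ≤ c := integral_nonneg hk0
  obtain ⟨y₀, hy₀⟩ : ∃ y₀ : ℝ, ∀ y, y₀ < y → c * (1 + y) ^ max (p - 1) 0 + b < (1 - r) * y ^ q := by
    have h1 : Tendsto (fun y : ℝ => (c * (1 + y) ^ max (p - 1) 0 + b) / y ^ q) atTop (nhds 0) := by
      have h2 : Tendsto (fun y : ℝ => c * 2 ^ max (p - 1) 0 * y ^ (-(q - max (p - 1) 0)) +
          b * y ^ (-q)) atTop (nhds 0) := by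
        simpa using ((tendsto_rpow_neg_atTop (sub_pos.2 hq1)).const_mul
          (c * 2 ^ max (p - 1) 0)).add ((tendsto_rpow_neg_atTop hq).const_mul b)
      refine squeeze_zero' ?_ ?_ h2
      · filter_upwards [eventually_ge_atTop 1] with y hy
        positivity
      · filter_upwards [eventually_ge_atTop 1] with y hy
        have hy0 : 0 < y := by linarith
        rw [div_le_iff₀ (by positivity), add_mul, mul_assoc, mul_assoc b, ← Real.rpow_add hy0,
          ← Real.rpow_add hy0, neg_sub, sub_add_cancel, neg_add_cancel, Real.rpow_zero, mul_one,
          mul_assoc, ← Real.mul_rpow (by norm_num) hy0.le]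
        gcongr
        linarith
    obtain ⟨y₀, h⟩ := eventually_atTop.1 ((h1.eventually_lt_const (sub_pos.2 hr1)).and
      (eventually_gt_atTop 0))
    refine ⟨y₀, fun y hy => ?_⟩
    obtain ⟨h3, h4⟩ := h y hy.le
    rwa [div_lt_iff₀ (by positivity)] at h3
  set K : ℝ := max 1 (y₀ ^ (p - q)) with hK
  have hK1 : 1 ≤ K := le_max_left _ _
  have hKy : ∀ y, 0 ≤ y → K * y ^ q < y ^ p → y₀ < y := by
    intro y hy h
    have hy0 : 0 < y := by
      refine hy.lt_of_ne fun h0 => ?_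
      rw [← h0, Real.zero_rpow hq.ne', Real.zero_rpow hp.ne'] at h
      simp at h
    have h1 : K < y ^ (p - q) := by
      rw [Real.rpow_sub hy0, lt_div_iff₀ (by positivity)]; exact h
    by_contra! hle
    have : y ^ (p - q) ≤ y₀ ^ (p - q) := Real.rpow_le_rpow hy hle (by linarith)
    exact absurd (this.trans (le_max_right _ _)) (not_le.2 h1)
  let g : ℝ → ℝ := fun y => min (y ^ p) (K * y ^ q)
  have hgm : Measurable g := by fun_prop
  have hgπ : Integrable (fun x : ℝ => g |x|) π :=
    ((hmom q hq hqp).const_mul K).mono' (hgm.comp measurable_norm).aestronglyMeasurable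
      (Eventually.of_forall fun x => by
        rw [Real.norm_eq_abs, abs_of_nonneg (by simp only [g]; positivity)]
        exact min_le_right _ _)
  have hlaw := map_abs_archStep hsymm hst
  have hgW : Integrable (fun z : ℝ × ℝ => g |archStep α β lam z.2 (|z.1|)|) (π.prod ν) := by
    have h1 : Integrable g (π.map fun x => |x|) :=
      (integrable_map_measure hgm.aestronglyMeasurable (by fun_prop)).2 hgπ
    rw [← hlaw] at h1
    exact h1.comp_measurable hWm
  have hgA : Integrable (fun z : ℝ × ℝ => |α + Real.sqrt lam * z.2| ^ p * g |z.1|) (π.prod ν) :=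
    (hgπ.mul_prod hA).congr (Eventually.of_forall fun z => mul_comm _ _)
  have hg0 : ∫ z : ℝ × ℝ, (g |archStep α β lam z.2 (|z.1|)| -
      |α + Real.sqrt lam * z.2| ^ p * g |z.1|) ∂(π.prod ν) = 0 := by
    rw [integral_sub hgW hgA, sub_eq_zero]
    have h1 : ∫ z : ℝ × ℝ, g |archStep α β lam z.2 (|z.1|)| ∂(π.prod ν) = ∫ x, g |x| ∂π := by
      rw [← integral_map (f := g) hWm.aemeasurable hgm.aestronglyMeasurable, hlaw,
        integral_map (by fun_prop) hgm.aestronglyMeasurable]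
    have h2 : ∫ z : ℝ × ℝ, |α + Real.sqrt lam * z.2| ^ p * g |z.1| ∂(π.prod ν) =
        ∫ x, g |x| ∂π := by
      have := integral_prod_mul (μ := π) (ν := ν) (fun x : ℝ => g |x|)
        (fun e => |α + Real.sqrt lam * e| ^ p)
      rw [hAp, mul_one] at this
      rw [← this]
      exact integral_congr_ae (Eventually.of_forall fun z => mul_comm _ _)
    rw [h1, h2]
  let H : ℝ × ℝ → ℝ := fun z => (|archStep α β lam z.2 (|z.1|)| ^ p -
    |α + Real.sqrt lam * z.2| ^ p * |z.1| ^ p) - (g |archStep α β lam z.2 (|z.1|)| -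
      |α + Real.sqrt lam * z.2| ^ p * g |z.1|)
  have hH : Integrable H (π.prod ν) := hint.sub (hgW.sub hgA)
  have hHeq : ∫ z : ℝ × ℝ, (|archStep α β lam z.2 (|z.1|)| ^ p -
      |α + Real.sqrt lam * z.2| ^ p * |z.1| ^ p) ∂(π.prod ν) =
      ∫ x, ∫ e, H (x, e) ∂ν ∂π := by
    rw [← integral_prod _ hH]
    have := integral_sub hint (hgW.sub hgA)
    simp only [Pi.sub_apply] at this
    rw [hg0, sub_zero] at this
    exact this.symm
  have hg_low : ∀ x, |x| ^ p ≤ K * |x| ^ q → 0 ≤ ∫ e, H (x, e) ∂ν := by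
    intro x hx
    refine integral_nonneg fun e => ?_
    simp only [H, g, Pi.zero_apply, min_eq_left hx]
    linarith [min_le_left (|archStep α β lam e (|x|)| ^ p) (K * |archStep α β lam e (|x|)| ^ q)]
  have hg_high : ∀ x, K * |x| ^ q < |x| ^ p → Integrable (fun e => H (x, e)) ν →
      0 < ∫ e, H (x, e) ∂ν := by
    intro x hx hHx
    have hy := hy₀ _ (hKy _ (abs_nonneg x) hx)
    obtain ⟨hWq, hWqle⟩ := hdrift |x|
    rw [abs_abs] at hWqle
    have hkx : Integrable (fun e => -(k e * (1 + |x|) ^ max (p - 1) 0)) ν := (hh.mul_const _).neg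
    have h2 : Integrable (fun e => K * |archStep α β lam e (|x|)| ^ q) ν := hWq.const_mul K
    have h3 : Integrable (fun e => |α + Real.sqrt lam * e| ^ p * (K * |x| ^ q)) ν := hA.mul_const _
    have h4 : Integrable (fun e => -(k e * (1 + |x|) ^ max (p - 1) 0) -
      K * |archStep α β lam e (|x|)| ^ q) ν := hkx.sub h2
    have h1 : ∫ e, (-(k e * (1 + |x|) ^ max (p - 1) 0) - K * |archStep α β lam e (|x|)| ^ q +
        |α + Real.sqrt lam * e| ^ p * (K * |x| ^ q)) ∂ν ≤ ∫ e, H (x, e) ∂ν := by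
      refine integral_mono (h4.add h3) hHx fun e => ?_
      simp only [H, g, min_eq_right hx.le]
      have h5 := neg_le_of_abs_le (hpt |x| e (abs_nonneg x))
      linarith [min_le_right (|archStep α β lam e (|x|)| ^ p)
        (K * |archStep α β lam e (|x|)| ^ q)]
    have e1 : ∫ e, k e * (1 + |x|) ^ max (p - 1) 0 ∂ν = c * (1 + |x|) ^ max (p - 1) 0 :=
      integral_mul_const _ k
    rw [integral_add h4 h3, integral_sub hkx h2, integral_neg, e1,
      integral_const_mul K, integral_mul_const, hAp, one_mul] at h1
    refine lt_of_lt_of_le ?_ h1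
    have h6 : K * (∫ e, |archStep α β lam e (|x|)| ^ q ∂ν) ≤ K * (r * |x| ^ q + b) := by gcongr
    have h7 : 0 ≤ c * (1 + |x|) ^ max (p - 1) 0 := by positivity
    nlinarith [mul_nonneg (sub_nonneg.2 hK1)
      (by linarith : 0 ≤ (1 - r) * |x| ^ q - b)]
  rw [hHeq]
  have hHx := hH.prod_right_ae
  refine (integral_pos_iff_support_of_nonneg_ae ?_ hH.integral_prod_left).2 ?_
  · filter_upwards [hHx] with x hx
    rcases le_or_gt (|x| ^ p) (K * |x| ^ q) with h | h
    · exact hg_low x h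
    · exact (hg_high x h hx).le
  · have hlim : Tendsto (fun y : ℝ => y ^ (p - q)) atTop atTop :=
      tendsto_rpow_atTop (sub_pos.2 hqp)
    obtain ⟨R, hR⟩ := eventually_atTop.1 ((hlim.eventually_gt_atTop K).and (eventually_gt_atTop 0))
    refine (hunb R).trans_le (measure_mono_ae ?_)
    filter_upwards [hHx] with x hx hxR
    obtain ⟨h1, h2⟩ := hR x (le_of_lt hxR)
    refine (hg_high x ?_ hx).ne'
    rw [abs_of_pos h2]
    rwa [Real.rpow_sub h2, lt_div_iff₀ (by positivity)] at h1

end ArchGap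

/-- Goldie's conditions for `a ^ 2` and exponent `κ`, restated for the nonnegative multiplier
`|a| ^ (2 * κ)`. -/
lemma SatisfiesIRT.abs_rpow_of_sq {Θ : Type*} [MeasurableSpace Θ] {ν : Measure Θ}
    [IsProbabilityMeasure ν] {a : Θ → ℝ} (ha : Measurable a) {κ : ℝ}
    (h : SatisfiesIRT ν (fun θ => a θ ^ 2) κ) :
    0 < κ ∧ (∫ θ, |a θ| ^ (2 * κ) ∂ν) = 1 ∧
      Integrable (fun θ => |a θ| ^ (2 * κ) * Real.log (|a θ| ^ (2 * κ))) ν ∧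
      ∀ c : ℝ, 0 < ν {θ | |a θ| ^ (2 * κ) ≠ 0 ∧
        ∀ k : ℤ, Real.log (|a θ| ^ (2 * κ)) ≠ c * k} := by
  obtain ⟨hκ, h1, h2, h3⟩ := h
  have hpow : ∀ θ, |a θ ^ 2| ^ κ = |a θ| ^ (2 * κ) := fun θ => by
    rw [abs_pow, Real.rpow_mul (abs_nonneg _), Real.rpow_two]
  have hlog : ∀ θ, a θ ≠ 0 → Real.log (|a θ| ^ (2 * κ)) = κ * Real.log |a θ ^ 2| := fun θ hθ => by
    rw [Real.log_rpow (abs_pos.2 hθ), abs_pow, Real.log_pow]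
    push_cast
    ring
  simp only [hpow] at h1 h2
  have hm : Measurable fun θ => |a θ| ^ (2 * κ) := ha.abs.pow_const _
  refine ⟨hκ, h1, ?_, fun c => ?_⟩
  · refine ((h2.const_mul κ).add (integrable_const 1)).mono'
      (hm.mul hm.log).aestronglyMeasurable (Eventually.of_forall fun θ => ?_)
    rw [Real.norm_eq_abs]
    change _ ≤ κ * (|a θ| ^ (2 * κ) * max (Real.log |a θ ^ 2|) 0) + 1
    have hnn : 0 ≤ |a θ| ^ (2 * κ) := by positivity
    by_cases h0 : a θ = 0
    · rw [h0, abs_zero, Real.zero_rpow (by positivity)]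
      simp
    have hpos : 0 < |a θ| ^ (2 * κ) := Real.rpow_pos_of_pos (abs_pos.2 h0) _
    have hle : 0 ≤ κ * (|a θ| ^ (2 * κ) * max (Real.log |a θ ^ 2|) 0) := by positivity
    rw [abs_le]
    constructor
    · have := mul_le_mul_of_nonneg_left (Real.one_sub_inv_le_log_of_pos hpos) hnn
      rw [mul_sub, mul_inv_cancel₀ hpos.ne'] at this
      linarith
    · rw [hlog θ h0, mul_left_comm]
      have : |a θ| ^ (2 * κ) * Real.log |a θ ^ 2| ≤
          |a θ| ^ (2 * κ) * max (Real.log |a θ ^ 2|) 0 := by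
        gcongr
        exact le_max_left _ _
      have := mul_le_mul_of_nonneg_left this hκ.le
      linarith
  · refine (h3 (c / κ)).trans_le (measure_mono fun θ hθ => ?_)
    have h0 : a θ ≠ 0 := fun h0 => hθ.1 (by simp [h0])
    refine ⟨(Real.rpow_pos_of_pos (abs_pos.2 h0) _).ne', fun k hk => hθ.2 k ?_⟩
    rw [hlog θ h0] at hk
    rw [div_mul_eq_mul_div, eq_div_iff hκ.ne', ← hk, mul_comm]

lemma measureReal_lt_abs_of_symm {π : Measure ℝ} [IsProbabilityMeasure π]
    (hsymm : π.map (fun x : ℝ => -x) = π) {t : ℝ} (ht : 0 ≤ t) :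
    π.real {x | t < |x|} = 2 * π.real (Ioi t) := by
  have h1 : {x : ℝ | t < |x|} = Ioi t ∪ Iio (-t) := by
    ext x
    simp only [mem_ofPred_eq, lt_abs, mem_union, mem_Ioi, mem_Iio]
    rw [lt_neg]
  have h2 : π (Iio (-t)) = π (Ioi t) := by
    conv_lhs => rw [← hsymm, Measure.map_apply measurable_neg measurableSet_Iio]
    congr 1
    ext x
    simp
  have h3 : Disjoint (Ioi t) (Iio (-t)) := by
    rw [Set.disjoint_left]
    intro x hx hx'
    simp only [mem_Ioi, mem_Iio] at hx hx'
    linarith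
  rw [h1, measureReal_union h3 measurableSet_Iio, Measure.real, Measure.real, h2]
  ring

/-- **Exact tail of the AR(1)-model with ARCH(1) errors.**  For the recursion
`Xₙ = αX_{n-1} + (β + λX_{n-1}²)^{1/2}εₙ` with iid nontrivial symmetric innovations
of law `ν`, `E log(α + λ^{1/2}|ε|) < 0` and `M = (α + λ^{1/2}η)²` satisfying
(IRT-1)–(IRT-3) for some `κ > 0`, the chain has a unique stationary law `π` and,
with `X ∼ π` independent of `η`,
`lim_{t→∞} t^{2κ} P(X > t) = E(Ψ(X²)^κ − (MX²)^κ)/(2κμ_κ) > 0`. -/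
theorem ar1_arch_tail
    (α β lam : ℝ) (hα : 0 ≤ α) (hβ : 0 < β) (hlam : 0 < lam)
    (ν : Measure ℝ) [IsProbabilityMeasure ν]
    (hsymm : Measure.map (fun x : ℝ => -x) ν = ν)
    (hnontriv : 0 < ν {x : ℝ | x ≠ 0})
    (hlogplus : Integrable (fun x => max (Real.log (α + Real.sqrt lam * |x|)) 0) ν)
    (hcontr : (∫ x, Real.log (α + Real.sqrt lam * |x|) ∂ν) < 0 ∨
      ¬ Integrable (fun x => Real.log (α + Real.sqrt lam * |x|)) ν)
    (κ : ℝ)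
    (hIRT : SatisfiesIRT ν (fun x => (α + Real.sqrt lam * x) ^ 2) κ) :
    ∃ π : Measure ℝ, ∃ _ : IsProbabilityMeasure π,
      -- π is the unique stationary law of the chain
      Measure.map (fun q : ℝ × ℝ => α * q.1 + Real.sqrt (β + lam * q.1 ^ 2) * q.2)
        (π.prod ν) = π ∧
      (∀ (π' : Measure ℝ) (_ : IsProbabilityMeasure π'),
        Measure.map (fun q : ℝ × ℝ => α * q.1 + Real.sqrt (β + lam * q.1 ^ 2) * q.2)
          (π'.prod ν) = π' → π' = π) ∧
      -- tail behavior: t^{2κ} P(X > t) → E(Ψ(X²)^κ − (MX²)^κ)/(2κμ_κ) > 0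
      0 < (∫ q : ℝ × ℝ,
            (((α + Real.sqrt lam * q.2) ^ 2 * q.1 ^ 2 +
                2 * α * β * q.2 * Real.sqrt (q.1 ^ 2) /
                  (Real.sqrt (β + lam * q.1 ^ 2) + Real.sqrt (lam * q.1 ^ 2)) +
                β * q.2 ^ 2) ^ κ -
              ((α + Real.sqrt lam * q.2) ^ 2 * q.1 ^ 2) ^ κ) ∂(π.prod ν)) /
          (2 * κ * ∫ x, ((α + Real.sqrt lam * x) ^ 2) ^ κ *
            Real.log ((α + Real.sqrt lam * x) ^ 2) ∂ν) ∧
      Tendsto (fun t : ℝ => t ^ (2 * κ) * (π (Ioi t)).toReal) atTop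
        (nhds ((∫ q : ℝ × ℝ,
            (((α + Real.sqrt lam * q.2) ^ 2 * q.1 ^ 2 +
                2 * α * β * q.2 * Real.sqrt (q.1 ^ 2) /
                  (Real.sqrt (β + lam * q.1 ^ 2) + Real.sqrt (lam * q.1 ^ 2)) +
                β * q.2 ^ 2) ^ κ -
              ((α + Real.sqrt lam * q.2) ^ 2 * q.1 ^ 2) ^ κ) ∂(π.prod ν)) /
          (2 * κ * ∫ x, ((α + Real.sqrt lam * x) ^ 2) ^ κ *
            Real.log ((α + Real.sqrt lam * x) ^ 2) ∂ν))) := by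
  have ham : Measurable fun e : ℝ => α + Real.sqrt lam * e := by fun_prop
  obtain ⟨hκ, hAp, hlog, hnonar⟩ := hIRT.abs_rpow_of_sq ham
  set p : ℝ := 2 * κ with hp_def
  have hp : 0 < p := by positivity
  have hAm : Measurable fun e : ℝ => |α + Real.sqrt lam * e| ^ p := ham.abs.pow_const p
  have hA0 : ∀ e : ℝ, 0 ≤ |α + Real.sqrt lam * e| ^ p := fun e => by positivity
  have hA : Integrable (fun e : ℝ => |α + Real.sqrt lam * e| ^ p) ν := by
    by_contra h; rw [integral_undef h] at hAp; exact zero_ne_one hAp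
  have hne : 0 < ν {e : ℝ | |α + Real.sqrt lam * e| ^ p ≠ 1} := by
    refine (hnonar 0).trans_le (measure_mono fun e he h => he.2 0 ?_)
    rw [h]; simp
  have hA1 : ∀ q, 0 < q → q < p → Integrable (fun e => |α + Real.sqrt lam * e| ^ q) ν ∧
      ∫ e, |α + Real.sqrt lam * e| ^ q ∂ν < 1 := by
    intro q hq hqp
    have h := integral_rpow_lt_one hAm hA0 hAp hne (div_pos hq hp) ((div_lt_one hp).2 hqp)
    simpa only [← Real.rpow_mul (abs_nonneg _), mul_div_cancel₀ q hp.ne'] using h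
  have hgt : 0 < ν {e : ℝ | 1 < |α + Real.sqrt lam * e|} := by
    by_contra h0
    rw [not_lt, nonpos_iff_eq_zero] at h0
    have hle : ∀ᵐ e ∂ν, |α + Real.sqrt lam * e| ^ p ≤ 1 := by
      filter_upwards [measure_eq_zero_iff_ae_notMem.1 h0] with e he
      exact Real.rpow_le_one (abs_nonneg _) (not_lt.1 he) hp.le
    have h1 : ∫ e, (1 - |α + Real.sqrt lam * e| ^ p) ∂ν = 0 := by
      rw [integral_sub (integrable_const 1) hA, hAp]; simp
    rw [integral_eq_zero_iff_of_nonneg_ae (hle.mono fun e he => sub_nonneg.2 he)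
      ((integrable_const 1).sub hA)] at h1
    refine hne.ne' (measure_eq_zero_iff_ae_notMem.2 ?_)
    filter_upwards [h1] with e he h
    exact h (sub_eq_zero.1 he).symm
  obtain ⟨π, hπ, hst, huniq, hπsymm, hmom⟩ := exists_stationary_archStep hα hβ hlam hsymm
    hlogplus hcontr hp hA hA1
  have hunb := measure_Ioi_pos_of_stationary hβ hlam hsymm hnontriv hα hgt hπsymm hst
  obtain ⟨hint, hpos⟩ := integrable_and_integral_gap_pos hα hβ hlam hsymm hst hp hA hAp hA1
    hmom hunb
  have hWm : Measurable fun q : ℝ × ℝ => |archStep α β lam q.2 (|q.1|)| :=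
    ((measurable_archStep α β lam).comp (measurable_snd.prodMk measurable_fst.abs)).abs
  have hpm : Measurable fun y : ℝ => y ^ p := measurable_id.pow_const p
  have habs : Measurable fun x : ℝ => |x| := by fun_prop
  have hlaw : (π.prod ν).map (fun q => |archStep α β lam q.2 (|q.1|)| ^ p) =
      π.map fun x => |x| ^ p := by
    have h := congrArg (Measure.map fun y : ℝ => y ^ p) (map_abs_archStep hsymm hst)
    rwa [Measure.map_map hpm hWm, Measure.map_map hpm habs] at h
  have hlim := implicit_renewal (habs.pow_const p) hAm (hWm.pow_const p)
    (fun x => by positivity) hA0 (fun q => by positivity) hAp hlog hnonar hlaw hint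
  have hμ := integral_mul_log_pos hA0 hAp hlog hne
  have hsq : ∀ y : ℝ, (y ^ 2) ^ κ = |y| ^ p := fun y => by
    rw [hp_def, Real.rpow_mul (abs_nonneg _), Real.rpow_two, sq_abs]
  have hnum : ∀ q : ℝ × ℝ, ((α + Real.sqrt lam * q.2) ^ 2 * q.1 ^ 2 +
        2 * α * β * q.2 * Real.sqrt (q.1 ^ 2) /
          (Real.sqrt (β + lam * q.1 ^ 2) + Real.sqrt (lam * q.1 ^ 2)) +
        β * q.2 ^ 2) ^ κ - ((α + Real.sqrt lam * q.2) ^ 2 * q.1 ^ 2) ^ κ =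
      |archStep α β lam q.2 (|q.1|)| ^ p - |α + Real.sqrt lam * q.2| ^ p * |q.1| ^ p := fun q => by
    rw [sq_archStep_abs hβ hlam.le, hsq, ← mul_pow, hsq, abs_mul,
      Real.mul_rpow (abs_nonneg _) (abs_nonneg _)]
  have hden : p * ∫ x, ((α + Real.sqrt lam * x) ^ 2) ^ κ *
        Real.log ((α + Real.sqrt lam * x) ^ 2) ∂ν =
      2 * ∫ x, |α + Real.sqrt lam * x| ^ p * Real.log (|α + Real.sqrt lam * x| ^ p) ∂ν := by
    rw [hp_def, mul_assoc, ← integral_const_mul]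
    congr 2
    funext x
    rw [hsq]
    by_cases h0 : α + Real.sqrt lam * x = 0
    · rw [h0, abs_zero, Real.zero_rpow hp.ne']; simp
    · rw [Real.log_rpow (abs_pos.2 h0), Real.log_abs, Real.log_pow, hp_def]
      push_cast
      ring
  refine ⟨π, hπ, hst, huniq, ?_⟩
  simp only [hnum]
  rw [hden]
  refine ⟨by positivity, ?_⟩
  have h := (hlim.comp (tendsto_rpow_atTop hp)).div_const 2
  rw [div_div, mul_comm _ (2 : ℝ)] at h
  refine h.congr' ?_
  filter_upwards [eventually_ge_atTop 0] with t ht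
  have hset : {x : ℝ | t ^ p < |x| ^ p} = {x | t < |x|} := by
    ext x
    exact Real.rpow_lt_rpow_iff ht (abs_nonneg x) hp
  simp only [Function.comp, hset]
  rw [measureReal_lt_abs_of_symm hπsymm ht, Measure.real]
  ring
end
end

section
/- Let α ≥ 0, β > 0, λ > 0, η ∈ ℝ and t ≥ 0. Then β(η² − αλ^{−1/2}η⁻) + (α + λ^{1/2}η)²t ≤ (α + λ^{1/2}η)²t + 2αβη t^{1/2}/((β + λt)^{1/2} + (λt)^{1/2}) + βη² ≤ β(η² + αλ^{−1/2}|η|) + (α + λ^{1/2}η)²t, where η⁻ = max(−η,0). -/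
theorem two_mul_sqrt_div_mem_Icc {b c t : ℝ} (hb : 0 ≤ b) (hc : 0 < c) :
    2 * √t / (√(b + c * t) + √(c * t)) ∈ Set.Icc 0 (√c)⁻¹ := by
  refine ⟨by positivity, div_le_of_le_mul₀ (by positivity) (by positivity) ?_⟩
  have hle : √(c * t) ≤ √(b + c * t) := Real.sqrt_le_sqrt (by linarith)
  have hsqrt : √t = (√c)⁻¹ * √(c * t) := by
    rw [Real.sqrt_mul hc.le, inv_mul_cancel_left₀ (Real.sqrt_pos.2 hc).ne']
  calc 2 * √t = (√c)⁻¹ * (√(c * t) + √(c * t)) := by rw [hsqrt]; ring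
    _ ≤ (√c)⁻¹ * (√(b + c * t) + √(c * t)) := by gcongr

/-- **Sandwich inequality for the squared AR(1)-with-ARCH(1)-errors map.**
For `α ≥ 0`, `β > 0`, `λ > 0`, `η ∈ ℝ` and `t ≥ 0`,
`β(η² − αλ^{−1/2}η⁻) + (α + λ^{1/2}η)²t
  ≤ (α + λ^{1/2}η)²t + 2αβη√t/(√(β+λt) + √(λt)) + βη²
  ≤ β(η² + αλ^{−1/2}|η|) + (α + λ^{1/2}η)²t`. -/
theorem arch_sandwich (α β lam η t : ℝ) (hα : 0 ≤ α) (hβ : 0 < β) (hlam : 0 < lam)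
    (ht : 0 ≤ t) :
    β * (η ^ 2 - α * (Real.sqrt lam)⁻¹ * max (-η) 0) + (α + Real.sqrt lam * η) ^ 2 * t ≤
        (α + Real.sqrt lam * η) ^ 2 * t +
          2 * α * β * η * Real.sqrt t /
            (Real.sqrt (β + lam * t) + Real.sqrt (lam * t)) +
          β * η ^ 2 ∧
      (α + Real.sqrt lam * η) ^ 2 * t +
          2 * α * β * η * Real.sqrt t /
            (Real.sqrt (β + lam * t) + Real.sqrt (lam * t)) +
          β * η ^ 2 ≤
        β * (η ^ 2 + α * (Real.sqrt lam)⁻¹ * |η|) + (α + Real.sqrt lam * η) ^ 2 * t := by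
  obtain ⟨hk0, hk1⟩ := two_mul_sqrt_div_mem_Icc (t := t) hβ.le hlam
  have hterm : 2 * α * β * η * √t / (√(β + lam * t) + √(lam * t)) =
      α * β * (η * (2 * √t / (√(β + lam * t) + √(lam * t)))) := by
    ring
  rw [hterm]
  set k := 2 * √t / (√(β + lam * t) + √(lam * t))
  have hαβ : 0 ≤ α * β := mul_nonneg hα hβ.le
  have hlower : -((√lam)⁻¹ * max (-η) 0) ≤ η * k := by
    nlinarith [mul_le_mul_of_nonneg_right (le_max_left (-η) 0) hk0,
      mul_le_mul_of_nonneg_right hk1 (le_max_right (-η) 0)]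
  have hupper : η * k ≤ (√lam)⁻¹ * |η| := by
    nlinarith [mul_le_mul_of_nonneg_right (le_abs_self η) hk0,
      mul_le_mul_of_nonneg_right hk1 (abs_nonneg η)]
  constructor
  · linarith [mul_le_mul_of_nonneg_left hlower hαβ]
  · linarith [mul_le_mul_of_nonneg_left hupper hαβ]
end

section
/- Let ξ, ξ₁, ξ₂, … be iid random variables with values in [1/4,∞) satisfying −∞ < E log ξ < 0, E|log(4ξ − 1)| < ∞, and (IRT-1)–(IRT-3) for some κ > 0, and consider the random logistic IFS Xₙ = ξₙ^{−1}X_{n−1}(1 − X_{n−1}). Then for any stationary distribution π of (Xₙ)ₙ≥₀ on (0,1), liminf_{x→∞} x^κ π̂((x,∞)) = liminf_{x↓0} x^{−κ}π((0,x)) ∈ (0,∞], where π̂((x,∞)) := π((0,1/x)) for x > 1; in particular the upper tail index of π̂ is at most κ. -/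
open MeasureTheory ProbabilityTheory Filter Set Topology
open scoped ENNReal

noncomputable section

theorem exists_pos_measure_Iic_neg (μ : Measure ℝ) (hneg : μ (Iio 0) ≠ 0) :
    ∃ a : ℝ, 0 < a ∧ μ (Iic (-(2 * a))) ≠ 0 := by
  by_contra! h
  refine hneg (measure_mono_null (t := ⋃ n : ℕ, Iic (-(2 * (1 / ((n : ℝ) + 1))))) ?_
    (measure_iUnion_null fun n => h _ (by positivity)))
  intro l hl
  obtain ⟨n, hn⟩ := exists_nat_one_div_lt (show (0 : ℝ) < -l / 2 by
    have : l < 0 := hl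
    linarith)
  exact mem_iUnion.2 ⟨n, by simp only [mem_Iic]; linarith⟩

theorem exists_setLIntegral_Ioi_lt {μ : Measure ℝ} {f : ℝ → ℝ≥0∞} (hf : Measurable f)
    (hfin : ∫⁻ l, f l ∂μ ≠ ∞) {ε : ℝ≥0∞} (hε : 0 < ε) :
    ∃ A : ℝ, 0 < A ∧ ∫⁻ l in Ioi A, f l ∂μ < ε := by
  have hlim : Tendsto (fun n : ℕ => ∫⁻ l, (Ioi (n : ℝ)).indicator f l ∂μ) atTop
      (𝓝 (∫⁻ _, 0 ∂μ)) := by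
    refine tendsto_lintegral_of_dominated_convergence f
      (fun n => hf.indicator measurableSet_Ioi)
      (fun n => Eventually.of_forall fun l => indicator_le_self _ _ _) hfin
      (Eventually.of_forall fun l => ?_)
    obtain ⟨N, hN⟩ := exists_nat_ge l
    refine tendsto_const_nhds.congr' ?_
    filter_upwards [eventually_ge_atTop N] with n hn
    have : (N : ℝ) ≤ n := by exact_mod_cast hn
    rw [indicator_of_notMem]
    simp only [mem_Ioi, not_lt]
    linarith
  rw [lintegral_zero] at hlim
  obtain ⟨n, hn, hn'⟩ := ((hlim.eventually (gt_mem_nhds hε)).and (eventually_gt_atTop 0)).exists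
  refine ⟨n, by exact_mod_cast hn', ?_⟩
  rwa [lintegral_indicator measurableSet_Ioi] at hn

/-- The superharmonicity defect of `H` at scale `a` to the left of the origin. -/
theorem lintegral_translate_add_le {κ a t : ℝ} (μ : Measure ℝ) [IsProbabilityMeasure μ]
    (hκ : 0 < κ) {H : ℝ → ℝ≥0∞} (hexp : ∀ t, H t ≤ ENNReal.ofReal (Real.exp (-(κ * t))))
    (hone : ∀ t < 0, H t = 1) (ha : 0 < a) (ht : t ∈ Ico (-a) 0) :
    ∫⁻ l, H (t - l) ∂μ +
      (1 - ENNReal.ofReal (Real.exp (-(κ * a)))) * μ (Iic (-(2 * a))) ≤ H t := by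
  have hle1 (s : ℝ) : H s ≤ 1 := by
    rcases lt_or_ge s 0 with hs | hs
    · exact (hone s hs).le
    · refine (hexp s).trans ?_
      rw [ENNReal.ofReal_le_one, Real.exp_le_one_iff]
      nlinarith
  have hq : ENNReal.ofReal (Real.exp (-(κ * a))) ≤ 1 := by
    rw [ENNReal.ofReal_le_one, Real.exp_le_one_iff]
    nlinarith
  rw [hone t ht.2, ← lintegral_indicator_const measurableSet_Iic, ← lintegral_add_right _
    (measurable_const.indicator measurableSet_Iic)]
  calc _ ≤ ∫⁻ _, 1 ∂μ := lintegral_mono fun l => ?_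
    _ = 1 := by simp
  by_cases hl : l ∈ Iic (-(2 * a))
  · simp only [indicator_of_mem hl]
    refine (add_le_add_left ((hexp _).trans (ENNReal.ofReal_le_ofReal
      (Real.exp_le_exp.2 (neg_le_neg (mul_le_mul_of_nonneg_left ?_ hκ.le))))) _).trans
      (add_tsub_cancel_of_le hq).le
    have := mem_Iic.1 hl
    have := ht.1
    linarith
  · simp only [indicator_of_notMem hl, add_zero]
    exact hle1 _

/-- A bounded excessive function for a random walk whose tilted step has integrable positive part,
which grows like `exp (κ t)` on the negative half line, is bounded away from zero at infinity. -/
theorem exists_pos_le_exp_mul_of_superharmonic {κ : ℝ} (hκ : 0 < κ) (μ : Measure ℝ)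
    [IsProbabilityMeasure μ]
    (hw : ∫⁻ l, ENNReal.ofReal (Real.exp (κ * l)) ∂μ = 1)
    (hlog : ∫⁻ l, ENNReal.ofReal (Real.exp (κ * l) * max l 0) ∂μ ≠ ∞)
    (hneg : μ (Iio 0) ≠ 0) {H : ℝ → ℝ≥0∞} (hanti : Antitone H)
    (hexp : ∀ t, H t ≤ ENNReal.ofReal (Real.exp (-(κ * t))))
    (hone : ∀ t < 0, H t = 1) (hsuper : ∀ t, ∫⁻ l, H (t - l) ∂μ ≤ H t) :
    ∃ c : ℝ≥0∞, 0 < c ∧ ∀ t, 0 ≤ t → c ≤ ENNReal.ofReal (Real.exp (κ * t)) * H t := by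
  have hHm : Measurable H := hanti.measurable
  set w : ℝ → ℝ≥0∞ := fun l => ENNReal.ofReal (Real.exp (κ * l)) with hwdef
  have hwm : Measurable w := by fun_prop
  have hwadd (s t : ℝ) : w (s + t) = w s * w t := by
    simp only [hwdef]
    rw [← ENNReal.ofReal_mul (Real.exp_nonneg _), ← Real.exp_add, mul_add]
  set G : ℝ → ℝ≥0∞ := fun t => w t * H t with hGdef
  have hGm : Measurable G := hwm.mul hHm
  have hG1 (t : ℝ) : G t ≤ 1 := by
    refine (mul_le_mul_right (hexp t) _).trans ?_
    simp only [hwdef]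
    rw [← ENNReal.ofReal_mul (Real.exp_nonneg _), ← Real.exp_add]
    simp
  have hGw (t : ℝ) (ht : t < 0) : G t = w t := by simp [hGdef, hone t ht]
  have hconv (t : ℝ) : ∫⁻ l, w l * G (t - l) ∂μ = w t * ∫⁻ l, H (t - l) ∂μ := by
    rw [← lintegral_const_mul _ (by fun_prop)]
    refine lintegral_congr fun l => ?_
    simp only [hGdef]
    rw [← mul_assoc, ← hwadd, add_sub_cancel]
  obtain ⟨a, ha, hp⟩ := exists_pos_measure_Iic_neg μ hneg
  set d : ℝ≥0∞ := w (-a) * ((1 - ENNReal.ofReal (Real.exp (-(κ * a)))) * μ (Iic (-(2 * a))))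
    with hd
  have hdpos : d ≠ 0 := by
    refine mul_ne_zero ?_ (mul_ne_zero ?_ hp)
    · simp [hwdef, Real.exp_pos]
    · rw [Ne, tsub_eq_zero_iff_le, not_le, ENNReal.ofReal_lt_one, Real.exp_lt_one_iff]
      nlinarith
  have hdef (t : ℝ) : ∫⁻ l, w l * G (t - l) ∂μ + (Ico (-a) 0).indicator (fun _ => d) t ≤ G t := by
    rw [hconv]
    by_cases ht : t ∈ Ico (-a) 0
    · rw [indicator_of_mem ht]
      calc _ ≤ w t * ∫⁻ l, H (t - l) ∂μ +
            w t * ((1 - ENNReal.ofReal (Real.exp (-(κ * a)))) * μ (Iic (-(2 * a)))) := by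
            rw [hd]
            gcongr
            refine ENNReal.ofReal_le_ofReal (Real.exp_le_exp.2 ?_)
            exact mul_le_mul_of_nonneg_left ht.1 hκ.le
        _ ≤ _ := by
            rw [← mul_add]
            exact mul_le_mul_right (lintegral_translate_add_le μ hκ hexp hone ha ht) _
    · rw [indicator_of_notMem ht, add_zero]
      exact mul_le_mul_right (hsuper t) _
  set I : ℝ → ℝ≥0∞ := fun t => ∫⁻ s in Iic t, G s with hI
  have hImono : Monotone I := fun s t h => lintegral_mono_set (Iic_subset_Iic.2 h)
  have hIadd {s t : ℝ} (h : s ≤ t) : I t = I s + ∫⁻ u in Ioc s t, G u := by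
    simp only [hI]
    rw [← Iic_union_Ioc_eq_Iic h, lintegral_union measurableSet_Ioc]
    exact Iic_disjoint_Ioc le_rfl
  have hIfin (t : ℝ) : I t ≠ ∞ := by
    have hioc (s u : ℝ) : ∫⁻ v in Ioc s u, G v ≠ ∞ := by
      refine ne_top_of_le_ne_top ?_ (lintegral_mono fun v => hG1 v)
      simp
    have hneg1 : I (-1) ≠ ∞ := by
      have h1 : I (-1) ≤ ∫⁻ s in Iic (-1), w s := by
        refine lintegral_mono_ae ?_
        filter_upwards [ae_restrict_mem measurableSet_Iic] with s hs
        exact (hGw s (by have := mem_Iic.1 hs; linarith)).le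
      refine ne_top_of_le_ne_top ?_ h1
      exact (integrableOn_exp_mul_Iic hκ (-1)).lintegral_lt_top.ne
    rcases le_total t (-1) with h | h
    · exact ne_top_of_le_ne_top hneg1 (hImono h)
    · rw [hIadd h]
      exact ENNReal.add_ne_top.2 ⟨hneg1, hioc _ _⟩
  have hshift (t l : ℝ) : ∫⁻ s in Iic t, G (s - l) = I (t - l) := by
    simp only [hI]
    rw [← lintegral_indicator measurableSet_Iic, ← lintegral_indicator measurableSet_Iic,
      ← lintegral_sub_right_eq_self ((Iic (t - l)).indicator G) l]
    refine lintegral_congr fun s => ?_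
    simp [indicator_apply]
  have hIsuper (t : ℝ) (ht : 0 ≤ t) :
      ∫⁻ l, w l * I (t - l) ∂μ + d * ENNReal.ofReal a ≤ I t := by
    calc _ = ∫⁻ s in Iic t, (∫⁻ l, w l * G (s - l) ∂μ +
          (Ico (-a) 0).indicator (fun _ => d) s) := by
          rw [lintegral_add_right _ (measurable_const.indicator measurableSet_Ico)]
          congr 1
          · rw [lintegral_lintegral_swap]
            · refine lintegral_congr fun l => ?_
              rw [lintegral_const_mul _ (by fun_prop), hshift]
            · exact Measurable.aemeasurable (by fun_prop)
          · rw [lintegral_indicator_const measurableSet_Ico,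
              Measure.restrict_apply measurableSet_Ico,
              inter_eq_left.2 (Ico_subset_Iio_self.trans (Iio_subset_Iic_self.trans (Iic_subset_Iic.2 ht)))]
            simp
      _ ≤ I t := lintegral_mono hdef
  have hδ : 0 < d * ENNReal.ofReal a := pos_iff_ne_zero.2 (mul_ne_zero hdpos (by simpa using ha))
  obtain ⟨A, hA, hε⟩ := exists_setLIntegral_Ioi_lt (by fun_prop) hlog hδ
  set ε : ℝ≥0∞ := ∫⁻ l in Ioi A, ENNReal.ofReal (Real.exp (κ * l) * max l 0) ∂μ with hεdef
  have hupper (t : ℝ) :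
      I t ≤ ∫⁻ l, w l * I (t - l) ∂μ + ((∫⁻ u in Ioc (t - A) t, G u) + ε) := by
    have hpt (l : ℝ) : w l * I t ≤ w l * I (t - l) + ((w l * ∫⁻ u in Ioc (t - A) t, G u) +
        (Ioi A).indicator (fun l => ENNReal.ofReal (Real.exp (κ * l) * max l 0)) l) := by
      rcases le_total l 0 with hl | hl
      · exact (mul_le_mul_right (hImono (by linarith)) _).trans le_self_add
      rw [hIadd (show t - l ≤ t by linarith), mul_add]
      refine add_le_add_right ?_ _
      by_cases hlA : l ∈ Ioi A
      · refine le_add_left ?_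
        rw [indicator_of_mem hlA, ENNReal.ofReal_mul (Real.exp_nonneg _), max_eq_left hl]
        refine mul_le_mul_right ((lintegral_mono fun v => hG1 v).trans ?_) _
        simp
      · refine le_add_right (mul_le_mul_right (lintegral_mono_set (Ioc_subset_Ioc_left ?_)) _)
        have := not_lt.1 (mem_Ioi.not.1 hlA)
        linarith
    have hmono := lintegral_mono (μ := μ) hpt
    have hIm : Measurable I := hImono.measurable
    rwa [lintegral_mul_const _ hwm, hw, one_mul, lintegral_add_left (by fun_prop),
      lintegral_add_left (by fun_prop), lintegral_mul_const _ hwm, hw, one_mul,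
      lintegral_indicator measurableSet_Ioi] at hmono
  have hwindow (t : ℝ) (ht : 0 ≤ t) :
      d * ENNReal.ofReal a - ε ≤ ∫⁻ u in Ioc (t - A) t, G u := by
    rw [tsub_le_iff_right]
    refine (ENNReal.add_le_add_iff_left ?_).1 ((hIsuper t ht).trans (hupper t))
    exact ne_top_of_le_ne_top (hIfin t) (le_self_add.trans (hIsuper t ht))
  refine ⟨(d * ENNReal.ofReal a - ε) / (w A * ENNReal.ofReal A), ?_, fun t ht => ?_⟩
  · exact ENNReal.div_pos (tsub_pos_of_lt hε).ne'
      (ENNReal.mul_ne_top ENNReal.ofReal_ne_top ENNReal.ofReal_ne_top)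
  · refine ENNReal.div_le_of_le_mul ((hwindow (t + A) (by linarith)).trans ?_)
    calc _ ≤ ∫⁻ _ in Ioc (t + A - A) (t + A), w A * G t := by
          refine lintegral_mono_ae ?_
          filter_upwards [ae_restrict_mem measurableSet_Ioc] with u hu
          rw [add_sub_cancel_right] at hu
          calc G u ≤ w (A + t) * H t := by
                refine mul_le_mul' (ENNReal.ofReal_le_ofReal (Real.exp_le_exp.2 ?_))
                  (hanti hu.1.le)
                exact mul_le_mul_of_nonneg_left (by linarith [hu.2]) hκ.le
            _ = w A * G t := by rw [hwadd, mul_assoc]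
      _ = w t * H t * (w A * ENNReal.ofReal A) := by
          rw [setLIntegral_const, Real.volume_Ioc]
          simp only [hGdef, add_sub_cancel_left, add_sub_cancel_right]
          ring

theorem lintegral_measure_Ioo_mul_le {ν π : Measure ℝ} [SFinite ν]
    [IsProbabilityMeasure π] (hpos : ∀ᵐ x ∂ν, 0 < x) (hπsupp : π (Ioo 0 1) = 1)
    (hπstat : Measure.map (fun q : ℝ × ℝ => q.1 * (1 - q.1) / q.2) (π.prod ν) = π) (y : ℝ) :
    ∫⁻ x, π (Ioo 0 (x * y)) ∂ν ≤ π (Ioo 0 y) := by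
  have hm : Measurable (fun q : ℝ × ℝ => q.1 * (1 - q.1) / q.2) := by fun_prop
  have hπ : ∀ᵐ z ∂π, z ∈ Ioo (0 : ℝ) 1 :=
    (prob_compl_eq_zero_iff measurableSet_Ioo).2 hπsupp
  conv_rhs => rw [← hπstat, Measure.map_apply hm measurableSet_Ioo,
    Measure.prod_apply_symm (hm measurableSet_Ioo)]
  refine lintegral_mono_ae ?_
  filter_upwards [hpos] with x hx
  refine measure_mono_ae ?_
  filter_upwards [hπ] with z hz hzy
  obtain ⟨hz0, hz1⟩ := hz
  refine ⟨div_pos (mul_pos hz0 (by linarith)) hx, ?_⟩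
  rw [div_lt_iff₀ hx]
  have : z < x * y := hzy.2
  nlinarith

theorem liminf_rpow_mul_measure_inv_eq (π : Measure ℝ) (κ : ℝ) :
    liminf (fun x : ℝ => ENNReal.ofReal (x ^ κ) * π (Ioo 0 x⁻¹)) atTop =
      liminf (fun x : ℝ => ENNReal.ofReal (x ^ (-κ)) * π (Ioo 0 x)) (𝓝[>] 0) := by
  rw [← inv_atTop₀ (𝕜 := ℝ), ← Filter.map_inv, ← liminf_comp]
  refine liminf_congr ?_
  filter_upwards [eventually_ge_atTop 0] with x hx
  simp [Real.inv_rpow hx, Real.rpow_neg hx]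

/-- **Random logistic transforms: lower bound for the stationary law at `0`.**
Let `ξ` take values in `[1/4,∞)` with `−∞ < E log ξ < 0`, `E|log(4ξ−1)| < ∞` and
(IRT-1)–(IRT-3) for some `κ > 0`.  For any stationary distribution `π` of
`Xₙ = ξₙ^{−1}X_{n−1}(1−X_{n−1})` on `(0,1)`,
`liminf_{x→∞} x^κ π̂((x,∞)) = liminf_{x↓0} x^{−κ} π((0,x)) ∈ (0,∞]`,
where `π̂((x,∞)) = π((0,1/x))`. -/
theorem logistic_lower_tail_bound
    (ν : Measure ℝ) [IsProbabilityMeasure ν]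
    (hsupp : ∀ᵐ x ∂ν, (1 : ℝ) / 4 ≤ x)
    (hlogInt : Integrable Real.log ν)
    (hlogNeg : (∫ x, Real.log x ∂ν) < 0)
    (hlog4 : Integrable (fun x => |Real.log (4 * x - 1)|) ν)
    (κ : ℝ) (hIRT : SatisfiesIRT ν id κ)
    (π : Measure ℝ) [IsProbabilityMeasure π]
    (hπsupp : π (Ioo 0 1) = 1)
    (hπstat : Measure.map (fun q : ℝ × ℝ => q.1 * (1 - q.1) / q.2) (π.prod ν) = π) :
    liminf (fun x : ℝ => ENNReal.ofReal (x ^ κ) * π (Ioo 0 x⁻¹)) atTop =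
        liminf (fun x : ℝ => ENNReal.ofReal (x ^ (-κ)) * π (Ioo 0 x)) (𝓝[>] 0) ∧
      0 < liminf (fun x : ℝ => ENNReal.ofReal (x ^ κ) * π (Ioo 0 x⁻¹)) atTop := by
  refine ⟨liminf_rpow_mul_measure_inv_eq π κ, ?_⟩
  obtain ⟨hκ, hone, hlog, -⟩ := hIRT
  simp only [id] at hone hlog
  have hpos : ∀ᵐ x ∂ν, 0 < x := hsupp.mono fun x hx => by linarith
  have hlogm := Real.measurable_log
  have hprob : IsProbabilityMeasure (ν.map Real.log) :=
    Measure.isProbabilityMeasure_map hlogm.aemeasurable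
  have hexplog {x : ℝ} (hx : 0 < x) : |x| ^ κ = Real.exp (κ * Real.log x) := by
    rw [abs_of_pos hx, Real.rpow_def_of_pos hx, mul_comm]
  have hw : ∫⁻ l, ENNReal.ofReal (Real.exp (κ * l)) ∂(ν.map Real.log) = 1 := by
    have hint : Integrable (fun x => |x| ^ κ) ν := .of_integral_ne_zero (by simp [hone])
    rw [lintegral_map (by fun_prop) hlogm, ← ENNReal.ofReal_one, ← hone,
      ofReal_integral_eq_lintegral_ofReal hint (Eventually.of_forall fun x => by positivity)]
    exact lintegral_congr_ae (hpos.mono fun x hx => by simp only [hexplog hx])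
  have hlog' : ∫⁻ l, ENNReal.ofReal (Real.exp (κ * l) * max l 0) ∂(ν.map Real.log) ≠ ∞ := by
    rw [lintegral_map (by fun_prop) hlogm]
    refine ne_top_of_le_ne_top hlog.lintegral_lt_top.ne (lintegral_mono_ae ?_)
    filter_upwards [hpos] with x hx
    rw [hexplog hx, Real.log_abs]
  have hneg : ν.map Real.log (Iio 0) ≠ 0 := fun h => by
    rw [Measure.map_apply hlogm measurableSet_Iio] at h
    refine hlogNeg.not_ge (integral_nonneg_of_ae ?_)
    filter_upwards [measure_eq_zero_iff_ae_notMem.1 h] with x hx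
    exact not_lt.1 hx
  set F : ℝ → ℝ≥0∞ := fun t => π (Ioo 0 (Real.exp (-t))) with hF
  have hFanti : Antitone F := fun s t h =>
    measure_mono (Ioo_subset_Ioo_right (Real.exp_le_exp.2 (neg_le_neg h)))
  have hFsuper (t : ℝ) : ∫⁻ l, F (t - l) ∂(ν.map Real.log) ≤ F t := by
    have hFm := hFanti.measurable
    rw [lintegral_map (by fun_prop) hlogm]
    refine le_of_eq_of_le (lintegral_congr_ae ?_)
      (lintegral_measure_Ioo_mul_le hpos hπsupp hπstat (Real.exp (-t)))
    filter_upwards [hpos] with x hx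
    simp only [hF]
    rw [neg_sub, Real.exp_sub, Real.exp_log hx, Real.exp_neg, div_eq_mul_inv]
  have hexpanti : Antitone fun t => ENNReal.ofReal (Real.exp (-(κ * t))) := fun s t h =>
    ENNReal.ofReal_le_ofReal (Real.exp_le_exp.2 (neg_le_neg (mul_le_mul_of_nonneg_left h hκ.le)))
  have hFneg (t : ℝ) (ht : t < 0) :
      min (F t) (ENNReal.ofReal (Real.exp (-(κ * t)))) = 1 := by
    have h1 : 1 ≤ F t := hπsupp.ge.trans
      (measure_mono (Ioo_subset_Ioo_right (Real.one_le_exp (by linarith))))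
    have h2 : 1 ≤ ENNReal.ofReal (Real.exp (-(κ * t))) := by
      rw [ENNReal.one_le_ofReal, Real.one_le_exp_iff]
      nlinarith
    exact le_antisymm ((min_le_left _ _).trans prob_le_one) (le_min h1 h2)
  have hexpsuper (t : ℝ) : ∫⁻ l, ENNReal.ofReal (Real.exp (-(κ * (t - l)))) ∂(ν.map Real.log) ≤
      ENNReal.ofReal (Real.exp (-(κ * t))) := by
    have hsplit (l : ℝ) : ENNReal.ofReal (Real.exp (-(κ * (t - l)))) =
        ENNReal.ofReal (Real.exp (-(κ * t))) * ENNReal.ofReal (Real.exp (κ * l)) := by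
      rw [← ENNReal.ofReal_mul (Real.exp_nonneg _), ← Real.exp_add]
      ring_nf
    simp only [hsplit]
    rw [lintegral_const_mul _ (by fun_prop), hw, mul_one]
  obtain ⟨c, hc, hbound⟩ := exists_pos_le_exp_mul_of_superharmonic hκ (ν.map Real.log) hw hlog' hneg
    (H := fun t => min (F t) (ENNReal.ofReal (Real.exp (-(κ * t)))))
    (hFanti.min hexpanti) (fun t => min_le_right _ _) hFneg fun t => le_min
      ((lintegral_mono fun l => min_le_left _ _).trans (hFsuper t))
      ((lintegral_mono fun l => min_le_right _ _).trans (hexpsuper t))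
  refine hc.trans_le (le_liminf_of_le (by isBoundedDefault) ?_)
  filter_upwards [eventually_ge_atTop 1] with x hx
  have hx0 : 0 < x := by linarith
  refine (hbound (Real.log x) (Real.log_nonneg hx)).trans ?_
  rw [← hexplog hx0, abs_of_pos hx0]
  refine mul_le_mul_right ((min_le_left _ _).trans_eq ?_) _
  simp only [hF]
  rw [Real.exp_neg, Real.exp_log hx0]
end
end
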